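/- arXiv:0810.4298 — 2 statements merged into one kernel-verified Lean document; each statement's English description precedes it below -/
import Mathlib

section
/- Fix d ≥ 2. Assume that every z ∈ X_{d+1} whose orbit A_{d+1}·z has compact closure in X_{d+1} has compact orbit A_{d+1}·z (Margulis's conjecture in dimension d+1). Then every grid in ℝ^d is L, i.e., the generalized Littlewood conjecture holds in dimension d. -/
open scoped BigOperators

noncomputable section

/-- `SL_d(ℝ)`. -/
abbrev SLd (d : ℕ) := Matrix.SpecialLinearGroup (Fin d) ℝ

/-- The unimodular lattice `gℤ^d ⊆ ℝ^d`. -/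
def latticeOf {d : ℕ} (g : SLd d) : Set (Fin d → ℝ) :=
  Set.range fun m : Fin d → ℤ => (g : Matrix (Fin d) (Fin d) ℝ).mulVec fun i => (m i : ℝ)

/-- A unimodular lattice in `ℝ^d` is a set of the form `gℤ^d` for some `g ∈ SL_d(ℝ)`. -/
def IsUnimodularLattice {d : ℕ} (x : Set (Fin d → ℝ)) : Prop :=
  ∃ g : SLd d, x = latticeOf g

/-- The grid `x + v`. -/
def grid {d : ℕ} (x : Set (Fin d → ℝ)) (v : Fin d → ℝ) : Set (Fin d → ℝ) :=
  (fun u => u + v) '' x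

/-- `N(y) = inf {|∏ i, w i| : w ∈ y}`. -/
def Ngrid {d : ℕ} (y : Set (Fin d → ℝ)) : ℝ :=
  sInf {r : ℝ | ∃ w ∈ y, r = |∏ i, w i|}

/-- The grid `x + v` is L (Littlewood): `inf {|n|·N(x + nv) : n ∈ ℤ, n ≠ 0} = 0`. -/
def IsL {d : ℕ} (x : Set (Fin d → ℝ)) (v : Fin d → ℝ) : Prop :=
  sInf {r : ℝ | ∃ n : ℤ, n ≠ 0 ∧ r = |(n : ℝ)| * Ngrid (grid x ((n : ℝ) • v))} = 0

/-- The grid `x + v` is FL (L of finite type): `N(x + nv) = 0` for some nonzero integer `n`. -/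
def IsFL {d : ℕ} (x : Set (Fin d → ℝ)) (v : Fin d → ℝ) : Prop :=
  ∃ n : ℤ, n ≠ 0 ∧ Ngrid (grid x ((n : ℝ) • v)) = 0

/-- A lattice `x` is GL if every grid `x + v` is L. -/
def IsGL {d : ℕ} (x : Set (Fin d → ℝ)) : Prop := ∀ v : Fin d → ℝ, IsL x v

/-- A lattice `x` is GFL if every grid `x + v` is FL. -/
def IsGFL {d : ℕ} (x : Set (Fin d → ℝ)) : Prop := ∀ v : Fin d → ℝ, IsFL x v

/-- The topology on `SL_d(ℝ)` induced from the space of matrices. -/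
instance (d : ℕ) : TopologicalSpace (SLd d) :=
  TopologicalSpace.induced (fun g : SLd d => (g : Matrix (Fin d) (Fin d) ℝ)) inferInstance

/-- Two elements of `SL_d(ℝ)` are identified iff they span the same lattice. -/
instance latSetoid (d : ℕ) : Setoid (SLd d) where
  r g h := latticeOf g = latticeOf h
  iseqv := ⟨fun _ => rfl, Eq.symm, Eq.trans⟩

/-- The space `X_d` of unimodular lattices in `ℝ^d`, as the quotient `SL_d(ℝ)/SL_d(ℤ)`
with the quotient topology. -/
def XSp (d : ℕ) := Quotient (latSetoid d)

instance (d : ℕ) : TopologicalSpace (XSp d) := instTopologicalSpaceQuotient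

/-- The lattice (a subset of `ℝ^d`) corresponding to a point of `X_d`. -/
def latticeOfX {d : ℕ} : XSp d → Set (Fin d → ℝ) := Quotient.lift latticeOf fun _ _ h => h

/-- `a ∈ A_d`: a diagonal matrix with positive diagonal entries (and determinant one,
since `a ∈ SL_d(ℝ)`). -/
def IsDiag {d : ℕ} (a : SLd d) : Prop :=
  (∀ i, 0 < (a : Matrix (Fin d) (Fin d) ℝ) i i) ∧
    ∀ i j, i ≠ j → (a : Matrix (Fin d) (Fin d) ℝ) i j = 0

/-- The orbit `A_d · z ⊆ X_d` of a lattice `z ∈ X_d` under the group `A_d` of diagonal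
matrices with positive entries and determinant one. -/
def Aorbit {d : ℕ} (z : XSp d) : Set (XSp d) :=
  {w | ∃ a g : SLd d, IsDiag a ∧ z = Quotient.mk (latSetoid d) g ∧
      w = Quotient.mk (latSetoid d) (a * g)}

noncomputable section
open Matrix

def qf {n : ℕ} (Q : Matrix (Fin n) (Fin n) ℝ) (x : Fin n → ℝ) : ℝ := ∑ i, ∑ j, Q i j * x i * x j

def ic {n : ℕ} (m : Fin n → ℤ) : Fin n → ℝ := fun i => (m i : ℝ)

lemma qf_eq {n : ℕ} (Q : Matrix (Fin n) (Fin n) ℝ) (x : Fin n → ℝ) :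
    qf Q x = x ⬝ᵥ (Q *ᵥ x) := by
  simp only [qf, dotProduct, mulVec, Finset.mul_sum]
  refine Finset.sum_congr rfl fun i _ => Finset.sum_congr rfl fun j _ => by ring

lemma qf_conj {n : ℕ} (Q B : Matrix (Fin n) (Fin n) ℝ) (x : Fin n → ℝ) :
    qf (Bᵀ * Q * B) x = qf Q (B *ᵥ x) := by
  rw [qf_eq, qf_eq, ← mulVec_mulVec, ← mulVec_mulVec, mulVec_transpose, dotProduct_comm,
    ← dotProduct_mulVec, dotProduct_comm]

lemma qf_smul {n : ℕ} (Q : Matrix (Fin n) (Fin n) ℝ) (t : ℝ) (x : Fin n → ℝ) :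
    qf Q (t • x) = t ^ 2 * qf Q x := by
  rw [qf_eq, qf_eq, mulVec_smul, smul_dotProduct, dotProduct_smul]
  simp only [smul_eq_mul]; ring

/-- Schur complement. -/
def schur {n : ℕ} (Q : Matrix (Fin (n+1)) (Fin (n+1)) ℝ) : Matrix (Fin n) (Fin n) ℝ :=
  fun i j => Q i.succ j.succ - Q 0 i.succ * Q 0 j.succ / Q 0 0

lemma schur_det {n : ℕ} (Q : Matrix (Fin (n+1)) (Fin (n+1)) ℝ) (hs : Q.IsSymm) (h0 : Q 0 0 ≠ 0) :
    Q.det = Q 0 0 * (schur Q).det := by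
  set B : Matrix (Fin (n+1)) (Fin (n+1)) ℝ := fun i j =>
    Q i j + (if i = 0 then 0 else - (Q 0 i / Q 0 0)) * Q 0 j with hB
  have hd : B.det = Q.det :=
    det_eq_of_forall_row_eq_smul_add_const (fun i => if i = 0 then 0 else - (Q 0 i / Q 0 0)) 0
      (by simp) (fun i j => rfl)
  rw [← hd, det_succ_column_zero, Fin.sum_univ_succ]
  have hz : ∀ i : Fin n, B i.succ 0 = 0 := by
    intro i
    have : Q i.succ 0 = Q 0 i.succ := hs.apply 0 i.succ
    simp only [hB, Fin.succ_ne_zero, if_false, this]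
    field_simp; ring
  have h1 : B.submatrix (Fin.succAbove 0) Fin.succ = schur Q := by
    ext i j
    change B (Fin.succAbove 0 i) j.succ = _
    rw [Fin.succAbove_zero]
    simp [hB, schur]
    ring
  rw [h1]
  simp [hz]
  left
  simp [hB]

lemma qf_schur {n : ℕ} (Q : Matrix (Fin (n+1)) (Fin (n+1)) ℝ) (hs : Q.IsSymm) (h0 : Q 0 0 ≠ 0)
    (x : Fin (n+1) → ℝ) :
    qf Q x = Q 0 0 * (x 0 + (∑ i : Fin n, Q 0 i.succ * x i.succ) / Q 0 0) ^ 2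
      + qf (schur Q) (fun i => x i.succ) := by
  have hs' : ∀ i : Fin n, Q i.succ 0 = Q 0 i.succ := fun i => hs.apply 0 i.succ
  set r := ∑ i : Fin n, Q 0 i.succ * x i.succ with hr
  have e1 : ∑ j : Fin n, Q 0 j.succ * x 0 * x j.succ = r * x 0 := by
    rw [hr, Finset.sum_mul]; exact Finset.sum_congr rfl fun j _ => by ring
  have e2 : ∑ i : Fin n, Q i.succ 0 * x i.succ * x 0 = r * x 0 := by
    rw [hr, Finset.sum_mul]; exact Finset.sum_congr rfl fun j _ => by rw [hs']
  have e3 : ∑ i : Fin n, ∑ j : Fin n, Q 0 i.succ * Q 0 j.succ / Q 0 0 * x i.succ * x j.succ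
      = r * r / Q 0 0 := by
    rw [hr, Finset.sum_mul_sum, Finset.sum_div]
    refine Finset.sum_congr rfl fun i _ => ?_
    rw [Finset.sum_div]
    refine Finset.sum_congr rfl fun j _ => by ring
  simp only [qf, Fin.sum_univ_succ, Finset.sum_add_distrib, schur, sub_mul, Finset.sum_sub_distrib]
  rw [e1, e2, e3]
  field_simp
  ring

lemma exists_basis_mult {n : ℕ} (m : Fin (n+1) → ℤ) (hm : m ≠ 0) :
    ∃ (β : Matrix (Fin (n+1)) (Fin (n+1)) ℤ) (t : ℤ), IsUnit β.det ∧ m = t • (fun i => β i 0) := by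
  obtain ⟨k, snf⟩ := Submodule.smithNormalForm (Pi.basisFun ℤ (Fin (n+1))) (Submodule.span ℤ {m})
  have hmem : m ∈ Submodule.span ℤ {m} := Submodule.mem_span_singleton_self m
  have hrep := snf.bN.sum_repr ⟨m, hmem⟩
  have hk : k = 1 := by
    have h1 := Module.finrank_eq_card_basis snf.bN
    rw [← (LinearEquiv.toSpanNonzeroSingleton ℤ _ m hm).finrank_eq] at h1
    simpa using h1.symm
  subst hk
  have hm2 := congrArg (Subtype.val) hrep
  simp only [Finset.univ_unique, Fin.default_eq_zero, Finset.sum_singleton] at hm2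
  rw [Submodule.coe_smul, snf.snf] at hm2
  let b := snf.bM.reindex (Equiv.swap (snf.f 0) 0)
  refine ⟨(Pi.basisFun ℤ (Fin (n+1))).toMatrix b, snf.bN.repr ⟨m, hmem⟩ 0 * snf.a 0, ?_, ?_⟩
  · rw [← Module.Basis.det_apply]
    exact (Pi.basisFun ℤ (Fin (n+1))).isUnit_det b
  · refine hm2.symm.trans ?_
    ext i
    simp [b, Module.Basis.toMatrix_apply, mul_assoc]

theorem red : ∀ (n : ℕ) (δ V : ℝ), 0 < δ → 0 ≤ V → ∃ C : ℝ, ∀ Q : Matrix (Fin n) (Fin n) ℝ,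
    Q.IsSymm → Q.det ≤ V → (∀ m : Fin n → ℤ, m ≠ 0 → δ ≤ qf Q (ic m)) →
    ∃ γ : Matrix (Fin n) (Fin n) ℤ, IsUnit γ.det ∧ ∀ i, qf Q (ic fun j => γ j i) ≤ C := by
  intro n
  induction n with
  | zero =>
    intro δ V _ _
    exact ⟨0, fun Q _ _ _ => ⟨1, by simp, fun i => i.elim0⟩⟩
  | succ n ih =>
    intro δ V hδ hV
    obtain ⟨C, hC⟩ := ih (δ/2) (V/δ) (by positivity) (by positivity)
    refine ⟨(max V (2*C)) + |C|, fun Q hs hdet hQ => ?_⟩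
    -- near minimum
    obtain ⟨m0, hm0, hmin⟩ : ∃ m0 : Fin (n+1) → ℤ, m0 ≠ 0 ∧
        ∀ m : Fin (n+1) → ℤ, m ≠ 0 → 6/7 * qf Q (ic m0) ≤ qf Q (ic m) := by
      set A : Set ℝ := {r | ∃ m : Fin (n+1) → ℤ, m ≠ 0 ∧ r = qf Q (ic m)} with hA
      have hne : A.Nonempty := ⟨_, fun _ => 1, fun h => by simpa using congrFun h 0, rfl⟩
      have hlb : δ ≤ sInf A := le_csInf hne (by rintro r ⟨m, hm, rfl⟩; exact hQ m hm)
      have hbb : BddBelow A := ⟨δ, by rintro r ⟨m, hm, rfl⟩; exact hQ m hm⟩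
      obtain ⟨r, ⟨m0, hm0, rfl⟩, hr⟩ := exists_lt_of_csInf_lt hne
        (show sInf A < 7/6 * sInf A by linarith)
      refine ⟨m0, hm0, fun m hm => ?_⟩
      have := csInf_le hbb ⟨m, hm, rfl⟩
      linarith
    obtain ⟨β, t, hβ, hmt⟩ := exists_basis_mult m0 hm0
    obtain ⟨βR, hβR⟩ : ∃ βR : Matrix (Fin (n+1)) (Fin (n+1)) ℝ, βR = β.map (Int.cast : ℤ → ℝ) := ⟨_, rfl⟩
    have hβdet : βR.det ^ 2 = 1 := by
      have : βR.det = (β.det : ℝ) := by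
        rw [hβR]; exact (RingHom.map_det (Int.castRingHom ℝ) β).symm
      rw [this]
      rcases Int.isUnit_iff.1 hβ with h | h <;> simp [h]
    obtain ⟨Q', hQ'⟩ : ∃ Q', Q' = βRᵀ * Q * βR := ⟨_, rfl⟩
    have hs' : Q'.IsSymm := by
      rw [Matrix.IsSymm, hQ', transpose_mul, transpose_mul, transpose_transpose, hs.eq, mul_assoc]
    have hdet' : Q'.det ≤ V := by
      rw [hQ', det_mul, det_mul, det_transpose]
      calc _ = βR.det ^ 2 * Q.det := by ring
        _ ≤ V := by rw [hβdet]; linarith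
    have hcast : ∀ m : Fin (n+1) → ℤ, βR *ᵥ ic m = ic (β *ᵥ m) := by
      intro m; ext i; simp [hβR, ic, mulVec, dotProduct]
    have hqq : ∀ m : Fin (n+1) → ℤ, qf Q' (ic m) = qf Q (ic (β *ᵥ m)) := by
      intro m; rw [hQ', qf_conj, hcast]
    have hinj : ∀ m : Fin (n+1) → ℤ, m ≠ 0 → β *ᵥ m ≠ 0 := by
      intro m hm h
      apply hm
      have h2 : β⁻¹ *ᵥ (β *ᵥ m) = m := by
        rw [mulVec_mulVec, nonsing_inv_mul _ hβ, one_mulVec]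
      rw [← h2, h, mulVec_zero]
    obtain ⟨q, hq⟩ : ∃ q, q = Q' 0 0 := ⟨_, rfl⟩
    have hcol : β *ᵥ (Pi.single 0 1) = fun i => β i 0 := by
      ext i; simp
    have hqe : q = qf Q (ic fun i => β i 0) := by
      rw [← hcol, ← hqq]
      have : (ic (Pi.single 0 1 : Fin (n+1) → ℤ)) = Pi.single 0 1 := by
        ext i; by_cases h : i = 0
        · subst h; simp [ic]
        · simp [ic, h]
      rw [this, qf_eq]; simp [hq]
    have hb0 : (fun i => β i 0) ≠ 0 := by
      rw [← hcol]; apply hinj; intro h; simpa using congrFun h 0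
    have hqδ : δ ≤ q := by rw [hqe]; exact hQ _ hb0
    have hq0 : 0 < q := by linarith
    have hqm : ∀ m : Fin (n+1) → ℤ, m ≠ 0 → 6/7 * q ≤ qf Q' (ic m) := by
      intro m hm
      rw [hqq]
      have h1 := hmin _ (hinj m hm)
      have h2 : q ≤ qf Q (ic m0) := by
        have : ic m0 = (t : ℝ) • ic (fun i => β i 0) := by
          rw [hmt]; ext i; simp [ic]
        rw [this, qf_smul, ← hqe]
        have ht : t ≠ 0 := by
          rintro rfl; apply hm0; rw [hmt]; simp
        have : (1 : ℝ) ≤ (t:ℝ)^2 := by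
          have : (1:ℤ) ≤ t^2 := by have := sq_pos_of_ne_zero ht; omega
          exact_mod_cast this
        nlinarith
      linarith
    have hround : ∀ y : Fin n → ℤ, ∃ k : ℤ,
        qf Q' (ic (Fin.cons k y)) ≤ q / 4 + qf (schur Q') (ic y) := by
      intro y
      set ρ := (∑ i : Fin n, Q' 0 i.succ * (y i : ℝ)) / q with hρ
      refine ⟨round (-ρ), ?_⟩
      rw [qf_schur Q' hs' (by rw [← hq]; exact hq0.ne')]
      simp only [ic, Fin.cons_zero, Fin.cons_succ]
      rw [← hq, ← hρ]
      have h1 : |(-ρ) - round (-ρ)| ≤ 1/2 := abs_sub_round _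
      have h2 : ((round (-ρ) : ℝ) + ρ)^2 ≤ 1/4 := by
        rw [abs_le] at h1
        nlinarith
      have : q * ((round (-ρ) : ℝ) + ρ)^2 ≤ q * (1/4) := by gcongr
      have h3 : qf (schur Q') (fun i => (y i : ℝ)) = qf (schur Q') (ic y) := rfl
      rw [h3]
      linarith
    have hsch : ∀ y : Fin n → ℤ, y ≠ 0 → q/2 ≤ qf (schur Q') (ic y) := by
      intro y hy
      obtain ⟨k, hk⟩ := hround y
      have : (Fin.cons k y : Fin (n+1) → ℤ) ≠ 0 := by
        intro h; apply hy; ext i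
        simpa using congrFun h i.succ
      have := hqm _ this
      linarith
    have hsS : (schur Q').IsSymm := by
      ext i j
      simp only [schur, transpose_apply]
      rw [hs'.apply]; ring
    have hdS : (schur Q').det ≤ V / δ := by
      rw [schur_det Q' hs' (by rw [← hq]; exact hq0.ne'), ← hq] at hdet'
      calc (schur Q').det ≤ V / q := by rw [le_div_iff₀ hq0]; linarith
        _ ≤ V / δ := by gcongr
    obtain ⟨γ', hγ', hγC⟩ := hC (schur Q') hsS hdS (fun m hm => by have := hsch m hm; linarith)
    have hqC : q ≤ max V (2*C) := by
      cases n with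
      | zero =>
        rw [schur_det Q' hs' (by rw [← hq]; exact hq0.ne'), ← hq] at hdet'
        simp at hdet'
        exact le_max_of_le_left hdet'
      | succ n =>
        have h1 := hγC 0
        have h2 : (fun j => γ' j 0) ≠ 0 := by
          intro h
          have : γ'.det = 0 := det_eq_zero_of_column_eq_zero 0 (fun i => congrFun h i)
          rw [this] at hγ'; simp at hγ'
        have h3 := hsch _ h2
        exact le_max_of_le_right (by linarith)
    choose k hk using fun i : Fin n => hround (fun j => γ' j i)
    set η : Matrix (Fin (n+1)) (Fin (n+1)) ℤ := fun a b =>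
      Fin.cases (Fin.cases 1 (fun _ => 0) a)
        (fun i => (Fin.cons (k i) (fun j => γ' j i) : Fin (n+1) → ℤ) a) b with hη
    have hηdet : η.det = γ'.det := by
      rw [det_succ_column_zero, Fin.sum_univ_succ]
      have h1 : η.submatrix (Fin.succAbove 0) Fin.succ = γ' := by
        ext i j
        change η (Fin.succAbove 0 i) j.succ = _
        rw [Fin.succAbove_zero]; simp [hη]
      rw [h1]
      simp [hη]
    refine ⟨β * η, by rw [det_mul, hηdet]; exact hβ.mul hγ', fun i => ?_⟩
    have hcolη : (fun j => (β * η) j i) = β *ᵥ (fun j => η j i) := by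
      ext j; simp [mul_apply, mulVec, dotProduct]
    rw [hcolη, ← hqq]
    have hCa := le_abs_self C
    refine Fin.cases ?_ (fun i => ?_) i
    · have : (fun j => η j 0) = Pi.single 0 1 := by
        ext j; refine Fin.cases ?_ (fun j => ?_) j <;> simp [hη]
      rw [this, hqq, hcol, ← hqe]
      have := abs_nonneg C
      linarith
    · have : (fun j => η j i.succ) = (Fin.cons (k i) (fun j => γ' j i) : Fin (n+1) → ℤ) := by
        ext j; simp [hη]
      rw [this]
      have h1 := hk i
      have h2 := hγC i
      linarith

end

noncomputable section
open Matrix Filter Topology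

abbrev SZ (n : ℕ) := Matrix.SpecialLinearGroup (Fin n) ℤ

def iota {n : ℕ} : SZ n →* SLd n := Matrix.SpecialLinearGroup.map (Int.castRingHom ℝ)

lemma iota_apply {n : ℕ} (γ : SZ n) (i j : Fin n) : (iota γ).1 i j = ((γ.1 i j : ℤ) : ℝ) := by
  simp [iota]

def lv {n : ℕ} (g : SLd n) (m : Fin n → ℤ) : Fin n → ℝ := g.1 *ᵥ ic m

lemma lv_mul {n : ℕ} (g h : SLd n) (m : Fin n → ℤ) : lv (g * h) m = g.1 *ᵥ lv h m := by
  unfold lv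
  rw [Matrix.SpecialLinearGroup.coe_mul, mulVec_mulVec]

lemma lv_iota {n : ℕ} (g : SLd n) (γ : SZ n) (m : Fin n → ℤ) :
    lv (g * iota γ) m = lv g (γ.1 *ᵥ m) := by
  rw [lv_mul]
  unfold lv
  congr 1
  ext i
  simp only [mulVec, dotProduct, ic, iota_apply]
  push_cast
  rfl

lemma gamma_ne {n : ℕ} (γ : SZ n) (m : Fin n → ℤ) (hm : m ≠ 0) : γ.1 *ᵥ m ≠ 0 := by
  intro h
  apply hm
  have h2 : (γ⁻¹).1 *ᵥ (γ.1 *ᵥ m) = m := by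
    have : (γ⁻¹).1 * γ.1 = 1 := by
      rw [← Matrix.SpecialLinearGroup.coe_mul, inv_mul_cancel, Matrix.SpecialLinearGroup.coe_one]
    rw [mulVec_mulVec, this, one_mulVec]
  rw [← h2, h, mulVec_zero]

def HH (n : ℕ) : Submodule ℝ (Fin n → ℝ) where
  carrier := {s | ∑ i, s i = 0}
  add_mem' := by
    intro a b ha hb
    simp only [Set.mem_ofPred_eq] at *
    simp [Finset.sum_add_distrib, ha, hb]
  zero_mem' := by simp
  smul_mem' := by
    intro c a ha
    simp only [Set.mem_ofPred_eq] at *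
    simp [← Finset.mul_sum, ha]

lemma HH_sum {n : ℕ} (s : HH n) : ∑ i, s.1 i = 0 := s.2

def D {n : ℕ} (s : HH n) : SLd n :=
  ⟨diagonal fun i => Real.exp (s.1 i), by
    rw [det_diagonal, ← Real.exp_sum, HH_sum, Real.exp_zero]⟩

lemma D_mul {n : ℕ} (s : HH n) (A : Matrix (Fin n) (Fin n) ℝ) (i j : Fin n) :
    ((D s).1 * A) i j = Real.exp (s.1 i) * A i j := by
  simp [D]

lemma mul_D {n : ℕ} (s : HH n) (A : Matrix (Fin n) (Fin n) ℝ) (i j : Fin n) :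
    (A * (D s).1) i j = A i j * Real.exp (s.1 j) := by
  simp [D]

lemma D_add {n : ℕ} (s t : HH n) : D (s + t) = D s * D t := by
  apply Subtype.ext
  rw [Matrix.SpecialLinearGroup.coe_mul]
  ext i j
  rw [D_mul]
  by_cases h : i = j
  · subst h; simp [D, Real.exp_add]
  · simp [D, h]

lemma D_zero {n : ℕ} : D (0 : HH n) = 1 := by
  apply Subtype.ext
  simp [D]

lemma D_neg {n : ℕ} (s : HH n) : D (-s) = (D s)⁻¹ := by
  rw [eq_inv_iff_mul_eq_one, ← D_add, neg_add_cancel, D_zero]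

lemma D_comm {n : ℕ} (s t : HH n) : D s * D t = D t * D s := by
  rw [← D_add, ← D_add, add_comm]

lemma lv_D {n : ℕ} (s : HH n) (g : SLd n) (m : Fin n → ℤ) (i : Fin n) :
    lv (D s * g) m i = Real.exp (s.1 i) * lv g m i := by
  rw [lv_mul]
  simp [D, mulVec_diagonal]

def PP {n : ℕ} (c : ℝ) (g : SLd n) : Prop := ∀ m : Fin n → ℤ, m ≠ 0 → c ≤ |∏ i, lv g m i|

lemma PP.iota {n : ℕ} {c : ℝ} {g : SLd n} (h : PP c g) (γ : SZ n) : PP c (g * _root_.iota γ) := by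
  intro m hm
  rw [lv_iota]
  exact h _ (gamma_ne γ m hm)

lemma PP.D {n : ℕ} {c : ℝ} {g : SLd n} (h : PP c g) (s : HH n) : PP c (_root_.D s * g) := by
  intro m hm
  simp only [lv_D, Finset.prod_mul_distrib]
  rw [← Real.exp_sum, HH_sum, Real.exp_zero, one_mul]
  exact h m hm

/-- entrywise convergence -/
def CV {n : ℕ} (u : ℕ → SLd n) (h : SLd n) : Prop :=
  ∀ i j, Tendsto (fun k => (u k).1 i j) atTop (𝓝 (h.1 i j))

lemma CV_iff {n : ℕ} (u : ℕ → SLd n) (h : SLd n) :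
    CV u h ↔ Tendsto (fun k => (u k).1) atTop (𝓝 h.1) := by
  unfold CV
  constructor
  · intro H
    exact tendsto_pi_nhds.2 fun i => tendsto_pi_nhds.2 fun j => H i j
  · intro H i j
    exact tendsto_pi_nhds.1 (tendsto_pi_nhds.1 H i) j

lemma CV.mul {n : ℕ} {u v : ℕ → SLd n} {g h : SLd n} (hu : CV u g) (hv : CV v h) :
    CV (fun k => u k * v k) (g * h) := by
  rw [CV_iff] at *
  simpa using hu.mul hv

lemma CV.const {n : ℕ} (g : SLd n) : CV (fun _ => g) g := fun _ _ => tendsto_const_nhds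

lemma CV.inv {n : ℕ} {u : ℕ → SLd n} {g : SLd n} (hu : CV u g) :
    CV (fun k => (u k)⁻¹) g⁻¹ := by
  rw [CV_iff] at *
  have : ∀ k, ((u k)⁻¹).1 = (u k).1.adjugate := fun k => Matrix.SpecialLinearGroup.coe_inv _
  simp_rw [this]
  rw [Matrix.SpecialLinearGroup.coe_inv]
  exact ((Continuous.matrix_adjugate continuous_id).tendsto _).comp hu

lemma CV.comp {n : ℕ} {u : ℕ → SLd n} {g : SLd n} (hu : CV u g) {φ : ℕ → ℕ}
    (hφ : Tendsto φ atTop atTop) : CV (fun k => u (φ k)) g :=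
  fun i j => (hu i j).comp hφ

lemma CV.unique {n : ℕ} {u : ℕ → SLd n} {g h : SLd n} (hu : CV u g) (hv : CV u h) : g = h := by
  apply Subtype.ext
  ext i j
  exact tendsto_nhds_unique (hu i j) (hv i j)

lemma CV.lv {n : ℕ} {u : ℕ → SLd n} {g : SLd n} (hu : CV u g) (m : Fin n → ℤ) (i : Fin n) :
    Tendsto (fun k => lv (u k) m i) atTop (𝓝 (_root_.lv g m i)) := by
  simp only [_root_.lv, mulVec, dotProduct]
  exact tendsto_finsetSum _ fun j _ => (hu i j).mul tendsto_const_nhds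

lemma PP.lim {n : ℕ} {c : ℝ} {u : ℕ → SLd n} {g : SLd n} (hu : CV u g)
    (h : ∀ᶠ k in atTop, PP c (u k)) : PP c g := by
  intro m hm
  have : Tendsto (fun k => |∏ i, lv (u k) m i|) atTop (𝓝 |∏ i, lv g m i|) :=
    (tendsto_finsetProd _ fun i _ => hu.lv m i).abs
  exact ge_of_tendsto this (h.mono fun k hk => hk m hm)

lemma CV.of_bdd {n : ℕ} {u : ℕ → SLd n} {C : ℝ} (h : ∀ k i j, |(u k).1 i j| ≤ C) :
    ∃ φ : ℕ → ℕ, StrictMono φ ∧ ∃ g, CV (fun k => u (φ k)) g := by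
  have hK : IsCompact (Set.pi Set.univ fun _ : Fin n => Set.pi Set.univ fun _ : Fin n =>
      Set.Icc (-C) C) := isCompact_univ_pi fun _ => isCompact_univ_pi fun _ => isCompact_Icc
  obtain ⟨a, ha, φ, hφ, hlim⟩ := hK.tendsto_subseq (x := fun k => fun i j => (u k).1 i j)
    (fun k i _ j _ => abs_le.1 (h k i j))
  have hlim' : Tendsto (fun k => (u (φ k)).1) atTop (𝓝 (Matrix.of a)) := hlim
  have hdet : (Matrix.of a).det = 1 := by
    have h1 : Tendsto (fun k => (u (φ k)).1.det) atTop (𝓝 (Matrix.of a).det) :=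
      ((Continuous.matrix_det continuous_id).tendsto _).comp hlim'
    have h2 : (fun k => (u (φ k)).1.det) = fun _ => (1:ℝ) := funext fun k => (u (φ k)).2
    rw [h2] at h1
    exact tendsto_nhds_unique h1 tendsto_const_nhds
  exact ⟨φ, hφ, ⟨Matrix.of a, hdet⟩, (CV_iff _ _).2 hlim'⟩

def SV {n : ℕ} (δ : ℝ) (g : SLd n) : Prop := ∀ m : Fin n → ℤ, m ≠ 0 → ∃ i, δ ≤ |lv g m i|

lemma PP.sv {n : ℕ} [NeZero n] {c : ℝ} {g : SLd n} (hc1 : c ≤ 1) (h : PP c g) : SV c g := by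
  intro m hm
  by_contra hcon
  push Not at hcon
  have h1 := h m hm
  rw [Finset.abs_prod] at h1
  have h0 : 0 ≤ |lv g m 0| := abs_nonneg _
  have h2 : ∏ i, |lv g m i| ≤ |lv g m 0| := by
    rw [← Finset.mul_prod_erase _ _ (Finset.mem_univ (0 : Fin n))]
    refine mul_le_of_le_one_right h0 (Finset.prod_le_one (fun i _ => abs_nonneg _) fun i _ => ?_)
    exact (hcon i).le.trans hc1
  linarith [hcon 0]

theorem mahlerC (n : ℕ) [NeZero n] (δ : ℝ) (hδ : 0 < δ) : ∃ C : ℝ, ∀ g : SLd n, SV δ g →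
    ∃ γ : SZ n, ∀ i j, |(g * iota γ).1 i j| ≤ C := by
  obtain ⟨C, hC⟩ := red n (δ^2) 1 (by positivity) zero_le_one
  refine ⟨Real.sqrt C, fun g hg => ?_⟩
  have hqf : ∀ x, qf (g.1ᵀ * 1 * g.1) x = ∑ i, (g.1 *ᵥ x) i ^ 2 := by
    intro x
    rw [qf_conj, qf_eq, one_mulVec]
    simp [dotProduct, sq]
  obtain ⟨γ, hγ, hγC⟩ := hC (g.1ᵀ * 1 * g.1) (by
      rw [Matrix.IsSymm]; simp [transpose_mul]) (by
      rw [det_mul, det_mul, det_transpose, g.2]; simp) (by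
      intro m hm
      rw [hqf]
      obtain ⟨i, hi⟩ := hg m hm
      calc δ^2 ≤ |lv g m i|^2 := by gcongr
        _ = (g.1 *ᵥ ic m) i ^ 2 := by rw [sq_abs]; rfl
        _ ≤ _ := Finset.single_le_sum (f := fun i => (g.1 *ᵥ ic m) i ^ 2)
            (fun i _ => sq_nonneg _) (Finset.mem_univ i))
  have hdd : γ.det * γ.det = 1 := by
    rcases Int.isUnit_iff.1 hγ with h | h <;> simp [h]
  let e : Fin n → ℤ := fun i => if i = 0 then γ.det else 1
  have hdet1 : (γ * diagonal e).det = 1 := by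
    rw [det_mul, det_diagonal, Finset.prod_ite_eq' Finset.univ 0 (fun _ => γ.det)]
    simpa using hdd
  obtain ⟨γ1, hγ1⟩ : ∃ γ1 : SZ n, γ1.1 = γ * diagonal e := ⟨⟨_, hdet1⟩, rfl⟩
  refine ⟨γ1, fun i j => ?_⟩
  · have he : |(e j : ℝ)| = 1 := by
      by_cases hj : j = 0
      · rcases Int.isUnit_iff.1 hγ with h | h <;> simp [e, hj, h]
      · simp [e, hj]
    have h1 : (g * iota γ1).1 i j = (g.1 *ᵥ (ic fun k => γ k j)) i * e j := by
      rw [Matrix.SpecialLinearGroup.coe_mul]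
      simp only [mul_apply, mulVec, dotProduct, Finset.sum_mul, ic]
      refine Finset.sum_congr rfl fun k _ => ?_
      rw [iota_apply, hγ1]
      simp [mul_assoc]
    rw [h1, abs_mul, he, mul_one]
    apply Real.abs_le_sqrt
    refine le_trans ?_ (hγC j)
    rw [hqf]
    exact Finset.single_le_sum (f := fun i => (g.1 *ᵥ ic fun k => γ k j) i ^ 2)
            (fun i _ => sq_nonneg _) (Finset.mem_univ i)

theorem SV.subseq {n : ℕ} [NeZero n] {δ : ℝ} (hδ : 0 < δ) (u : ℕ → SLd n) (h : ∀ k, SV δ (u k)) :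
    ∃ φ : ℕ → ℕ, StrictMono φ ∧ ∃ (γ : ℕ → SZ n) (g : SLd n),
      CV (fun k => u (φ k) * _root_.iota (γ k)) g := by
  obtain ⟨C, hC⟩ := mahlerC n δ hδ
  choose γ hγ using fun k => hC (u k) (h k)
  obtain ⟨φ, hφ, g, hg⟩ := CV.of_bdd (u := fun k => u k * iota (γ k)) hγ
  exact ⟨φ, hφ, fun k => γ (φ k), g, hg⟩

theorem PP.subseq {n : ℕ} [NeZero n] {c : ℝ} (hc : 0 < c) (u : ℕ → SLd n) (h : ∀ k, PP c (u k)) :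
    ∃ φ : ℕ → ℕ, StrictMono φ ∧ ∃ (γ : ℕ → SZ n) (g : SLd n),
      CV (fun k => u (φ k) * _root_.iota (γ k)) g ∧ PP c g := by
  have h' : ∀ k, PP (min c 1) (u k) := fun k m hm => (min_le_left _ _).trans (h k m hm)
  obtain ⟨φ, hφ, γ, g, hg⟩ := SV.subseq (lt_min hc one_pos) u
    (fun k => (h' k).sv (min_le_right _ _))
  exact ⟨φ, hφ, γ, g, hg, PP.lim hg (Eventually.of_forall fun k => (h _).iota _)⟩

end

noncomputable section
open Matrix Filter Topology

def Mg (n : ℕ) : Prop := ∀ c : ℝ, 0 < c → ∀ g : SLd n, PP c g →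
  ∀ (a : ℕ → HH n) (γ : ℕ → SZ n) (h : SLd n), CV (fun k => D (a k) * g * iota (γ k)) h →
    ∃ (s : HH n) (γ : SZ n), h = D s * g * iota γ

lemma latticeOf_eq {n : ℕ} (g : SLd n) : latticeOf g = Set.range (lv g) := rfl

lemma int_of_entries {n : ℕ} (h : SLd n) (hh : ∀ i j, ∃ z : ℤ, (z : ℝ) = h.1 i j) :
    ∃ γ : SZ n, h = iota γ := by
  choose B hB using hh
  have hmap : (Matrix.of B).map (Int.castRingHom ℝ) = h.1 := by
    ext i j; simp [hB]
  have hdet : (Matrix.of B).det = 1 := by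
    have h1 := RingHom.map_det (Int.castRingHom ℝ) (Matrix.of B)
    rw [RingHom.mapMatrix_apply, hmap, h.2] at h1
    simpa using h1
  refine ⟨⟨Matrix.of B, hdet⟩, ?_⟩
  apply Subtype.ext
  ext i j
  exact ((iota_apply _ i j).trans (hB i j)).symm

lemma lattice_iff {n : ℕ} (g h : SLd n) :
    latticeOf g = latticeOf h ↔ ∃ γ : SZ n, h = g * iota γ := by
  rw [latticeOf_eq, latticeOf_eq]
  constructor
  · intro H
    have hj : ∀ j : Fin n, ∃ m : Fin n → ℤ, lv g m = lv h (Pi.single j 1) := by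
      intro j
      have : lv h (Pi.single j 1) ∈ Set.range (lv g) := by rw [H]; exact ⟨_, rfl⟩
      exact this
    choose B hB using hj
    obtain ⟨γ, hγ⟩ := int_of_entries (g⁻¹ * h) (by
      intro i j
      refine ⟨B j i, ?_⟩
      have h1 : lv (g⁻¹ * h) (Pi.single j 1) = ic (B j) := by
        rw [lv_mul, ← hB, ← lv_mul, inv_mul_cancel]
        simp [lv]
      have h2 : lv (g⁻¹ * h) (Pi.single j 1) i = (g⁻¹ * h).1 i j := by
        have : (ic (Pi.single j 1 : Fin n → ℤ)) = Pi.single j 1 := by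
          ext i; by_cases h : i = j
          · subst h; simp [ic]
          · simp [ic, h]
        unfold lv
        rw [this]; simp
      rw [← h2, h1]; rfl)
    exact ⟨γ, by rw [← hγ]; group⟩
  · rintro ⟨γ, rfl⟩
    ext x
    constructor
    · rintro ⟨m, rfl⟩
      refine ⟨(γ⁻¹).1 *ᵥ m, ?_⟩
      rw [← lv_iota, mul_assoc, ← map_mul, mul_inv_cancel, map_one, mul_one]
    · rintro ⟨m, rfl⟩
      exact ⟨_, (lv_iota g γ m).symm⟩

lemma isDiag_D {n : ℕ} (s : HH n) : IsDiag (D s) := by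
  constructor
  · intro i
    simp [D, Real.exp_pos]
  · intro i j hij
    simp [D, hij]

lemma diag_eq_D {n : ℕ} (a : SLd n) (ha : IsDiag a) :
    ∃ s : HH n, a = D s ∧ ∀ i, s.1 i = Real.log (a.1 i i) := by
  have hd : a.1 = diagonal fun i => a.1 i i := by
    ext i j
    by_cases h : i = j
    · subst h; simp
    · rw [diagonal_apply_ne _ h]; exact ha.2 i j h
  have hprod : ∏ i, a.1 i i = 1 := by
    have := a.2
    rw [hd, det_diagonal] at this
    exact this
  refine ⟨⟨fun i => Real.log (a.1 i i), ?_⟩, ?_, fun i => rfl⟩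
  · change ∑ i, Real.log (a.1 i i) = 0
    rw [← Real.log_prod fun i _ => (ha.1 i).ne', hprod, Real.log_one]
  · apply Subtype.ext
    refine hd.trans ?_
    simp only [D]
    congr 1
    ext i
    simpa using (Real.exp_log (ha.1 i)).symm

abbrev mkX {n : ℕ} (g : SLd n) : XSp n := Quotient.mk (latSetoid n) g

lemma mkX_eq {n : ℕ} (g h : SLd n) : mkX g = mkX h ↔ ∃ γ : SZ n, h = g * iota γ := by
  rw [← lattice_iff]
  exact Quotient.eq (r := latSetoid n)

lemma val_inducing (n : ℕ) :
    Topology.IsInducing (fun g : SLd n => (g : Matrix (Fin n) (Fin n) ℝ)) := ⟨rfl⟩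

lemma val_cont (n : ℕ) : Continuous (fun g : SLd n => (g : Matrix (Fin n) (Fin n) ℝ)) :=
  (val_inducing n).continuous

lemma mkX_cont (n : ℕ) : Continuous (mkX (n := n)) := continuous_quotient_mk'

lemma mkX_surj (n : ℕ) : Function.Surjective (mkX (n := n)) := Quotient.mk_surjective

lemma mkX_openq (n : ℕ) : IsOpenQuotientMap (mkX (n := n)) := by
  refine ⟨mkX_surj n, mkX_cont n, ?_⟩
  intro U hU
  refine isOpen_coinduced.2 ?_
  have : (Quotient.mk (latSetoid n)) ⁻¹' (mkX '' U) =
      ⋃ γ : SZ n, {g : SLd n | g * iota γ ∈ U} := by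
    ext g
    simp only [Set.mem_preimage, Set.mem_image, Set.mem_iUnion, Set.mem_ofPred_eq]
    constructor
    · rintro ⟨x, hx, hxg⟩
      obtain ⟨γ, hγ⟩ := (mkX_eq g x).1 hxg.symm
      exact ⟨γ, hγ ▸ hx⟩
    · rintro ⟨γ, hγ⟩
      exact ⟨_, hγ, ((mkX_eq g _).2 ⟨γ, rfl⟩).symm⟩
  change IsOpen (Quotient.mk (latSetoid n) ⁻¹' (mkX '' U))
  rw [this]
  refine isOpen_iUnion fun γ => hU.preimage ?_
  rw [(val_inducing n).continuous_iff]
  change Continuous fun g : SLd n => (g * iota γ).1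
  simp only [Matrix.SpecialLinearGroup.coe_mul]
  exact (val_cont n).mul continuous_const

instance (n : ℕ) : T2Space (XSp n) := by
  rw [t2Space_iff_of_isOpenQuotientMap (mkX_openq n)]
  have : {q : SLd n × SLd n | mkX q.1 = mkX q.2} =
      ⋂ i, ⋂ j, {q : SLd n × SLd n | (q.1.1.adjugate * q.2.1) i j ∈ Set.range ((↑) : ℤ → ℝ)} := by
    ext q
    simp only [Set.mem_iInter, Set.mem_ofPred_eq]
    have hq : q.1.1.adjugate * q.2.1 = (q.1⁻¹ * q.2).1 := by
      rw [Matrix.SpecialLinearGroup.coe_mul, Matrix.SpecialLinearGroup.coe_inv]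
    rw [mkX_eq]
    constructor
    · rintro ⟨γ, hγ⟩ i j
      rw [hq, hγ, inv_mul_cancel_left]
      exact ⟨_, (iota_apply γ i j).symm⟩
    · intro H
      obtain ⟨γ, hγ⟩ := int_of_entries (q.1⁻¹ * q.2) (by
        intro i j; have := H i j; rw [hq] at this; exact this)
      exact ⟨γ, by rw [← hγ]; group⟩
  rw [this]
  refine isClosed_iInter fun i => isClosed_iInter fun j => ?_
  refine Int.isClosedEmbedding_coe_real.isClosed_range.preimage ?_
  have h1 : Continuous fun q : SLd n × SLd n => q.1.1.adjugate * q.2.1 :=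
    (((val_cont n).comp continuous_fst).matrix_adjugate).mul ((val_cont n).comp continuous_snd)
  exact h1.matrix_elem i j

def QQ (n : ℕ) (c : ℝ) : Set (XSp n) := {x | ∃ g : SLd n, x = mkX g ∧ PP c g}

lemma QQ_mk {n : ℕ} {c : ℝ} (g : SLd n) : mkX g ∈ QQ n c ↔ PP c g := by
  constructor
  · rintro ⟨h, hh, hP⟩
    obtain ⟨γ, rfl⟩ := (mkX_eq h g).1 hh.symm
    exact hP.iota γ
  · intro h; exact ⟨g, rfl, h⟩

lemma QQ_closed (n : ℕ) (c : ℝ) : IsClosed (QQ n c) := by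
  rw [← (mkX_openq n).isQuotientMap.isClosed_preimage]
  have : mkX ⁻¹' (QQ n c) = ⋂ m : Fin n → ℤ, ⋂ _ : m ≠ 0, {g : SLd n | c ≤ |∏ i, lv g m i|} := by
    ext g
    simp only [Set.mem_preimage, QQ_mk, Set.mem_iInter, Set.mem_ofPred_eq]
    rfl
  rw [this]
  refine isClosed_iInter fun m => isClosed_iInter fun _ => isClosed_le continuous_const ?_
  refine (continuous_finsetProd _ fun i _ => ?_).abs
  unfold lv
  have h1 : Continuous fun g : SLd n => g.1 *ᵥ ic m :=
    (val_cont n).matrix_mulVec continuous_const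
  exact (continuous_apply i).comp h1

lemma QQ_compact (n : ℕ) [NeZero n] (c : ℝ) (hc : 0 < c) : IsCompact (QQ n c) := by
  obtain ⟨C, hC⟩ := mahlerC n (min c 1) (lt_min hc one_pos)
  set K : Set (SLd n) := {g | ∀ i j, |g.1 i j| ≤ C} with hK
  have hKc : IsCompact K := by
    rw [(val_inducing n).isCompact_iff]
    have hcp : IsCompact (Set.pi Set.univ fun _ : Fin n => Set.pi Set.univ fun _ : Fin n =>
      Set.Icc (-C) C) := isCompact_univ_pi fun _ => isCompact_univ_pi fun _ => isCompact_Icc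
    have hcl : IsClosed {A : Matrix (Fin n) (Fin n) ℝ | A.det = 1} :=
      isClosed_eq (Continuous.matrix_det continuous_id) continuous_const
    have : (fun g : SLd n => (g : Matrix (Fin n) (Fin n) ℝ)) '' K =
        (Set.pi Set.univ fun _ : Fin n => Set.pi Set.univ fun _ : Fin n => Set.Icc (-C) C) ∩
        {A : Matrix (Fin n) (Fin n) ℝ | A.det = 1} := by
      ext A
      constructor
      · rintro ⟨g, hg, rfl⟩
        exact ⟨fun i _ j _ => abs_le.1 (hg i j), g.2⟩
      · rintro ⟨h1, h2⟩
        exact ⟨⟨A, h2⟩, fun i j => abs_le.2 (h1 i trivial j trivial), rfl⟩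
    rw [this]
    exact hcp.inter_right hcl
  refine (hKc.image (mkX_cont n)).of_isClosed_subset (QQ_closed n c) ?_
  rintro x ⟨g, rfl, hP⟩
  have h' : PP (min c 1) g := fun m hm => (min_le_left _ _).trans (hP m hm)
  obtain ⟨γ, hγ⟩ := hC g (h'.sv (min_le_right _ _))
  exact ⟨g * iota γ, hγ, ((mkX_eq _ _).2 ⟨γ, rfl⟩).symm⟩

theorem Mg_of (n : ℕ) [NeZero n]
    (hM : ∀ z : XSp n, IsCompact (closure (Aorbit z)) → IsCompact (Aorbit z)) : Mg n := by
  intro c hc g hg a γ h hcv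
  have hsub : Aorbit (mkX g) ⊆ QQ n c := by
    rintro w ⟨b, g', hb, hgg, rfl⟩
    obtain ⟨γ', rfl⟩ := (mkX_eq g g').1 hgg
    obtain ⟨s, rfl, -⟩ := diag_eq_D b hb
    exact (QQ_mk _).2 ((hg.iota γ').D s)
  have hcomp := hM (mkX g) ((QQ_compact n c hc).of_isClosed_subset isClosed_closure
    (closure_minimal hsub (QQ_closed n c)))
  have hcl := hcomp.isClosed
  have ht : Tendsto (fun k => D (a k) * g * iota (γ k)) atTop (𝓝 h) :=
    (val_inducing n).tendsto_nhds_iff.2 ((CV_iff _ _).1 hcv)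
  have ht2 : Tendsto (fun k => mkX (D (a k) * g * iota (γ k))) atTop (𝓝 (mkX h)) :=
    ((mkX_cont n).tendsto h).comp ht
  have hmem : mkX h ∈ Aorbit (mkX g) := by
    refine hcl.mem_of_tendsto ht2 (Eventually.of_forall fun k => ?_)
    refine ⟨D (a k), g * iota (γ k), isDiag_D _, (mkX_eq _ _).2 ⟨_, rfl⟩, ?_⟩
    rw [mul_assoc]
  obtain ⟨b, g', hb, hgg, hh⟩ := hmem
  obtain ⟨γ', rfl⟩ := (mkX_eq g g').1 hgg
  obtain ⟨s, rfl, -⟩ := diag_eq_D b hb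
  obtain ⟨γ'', h2⟩ := (mkX_eq _ _).1 hh.symm
  refine ⟨s, γ' * γ'', ?_⟩
  rw [h2, map_mul]; group

end

noncomputable section
open Matrix Filter Topology

lemma CV.int {n : ℕ} {γ : ℕ → SZ n} {h : SLd n} (hc : CV (fun k => iota (γ k)) h) :
    ∃ σ : SZ n, h = iota σ := by
  refine int_of_entries h fun i j => ?_
  have := (Int.isClosedEmbedding_coe_real.isClosed_range).mem_of_tendsto (hc i j)
    (Eventually.of_forall fun k => ⟨_, (iota_apply (γ k) i j).symm⟩)
  exact this

lemma lv_single {n : ℕ} (g : SLd n) (i j : Fin n) : lv g (Pi.single j 1) i = g.1 i j := by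
  have : ic (Pi.single j 1 : Fin n → ℤ) = Pi.single j 1 := by
    ext k
    by_cases h : k = j
    · subst h; simp [ic]
    · simp [ic, h]
  rw [lv, this]
  simp

lemma lv_ext {n : ℕ} {g h : SLd n} (H : ∀ m, lv g m = lv h m) : g = h := by
  apply Subtype.ext
  ext i j
  rw [← lv_single, H, lv_single]

lemma lv_sub {n : ℕ} (g : SLd n) (m m' : Fin n → ℤ) : lv g (m - m') = lv g m - lv g m' := by
  have : ic (m - m') = ic m - ic m' := by ext; simp [ic]
  rw [lv, this, mulVec_sub]; rfl

lemma conj_entry {n : ℕ} (t : HH n) (u : SLd n) (i j : Fin n) :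
    (D t * u * D (-t)).1 i j = Real.exp (t.1 i - t.1 j) * u.1 i j := by
  rw [Matrix.SpecialLinearGroup.coe_mul, mul_D, Matrix.SpecialLinearGroup.coe_mul, D_mul,
    sub_eq_add_neg, Real.exp_add]
  simp only [Submodule.coe_neg, Pi.neg_apply]
  ring

theorem lemA {n : ℕ} [NeZero n] (hM : Mg n) {c : ℝ} (hc : 0 < c) (g u : SLd n) (hg : PP c g)
    (hug : PP c (u * g)) (s : HH n)
    (hu : ∀ i j, ¬ s.1 j < s.1 i → u.1 i j = (1 : Matrix (Fin n) (Fin n) ℝ) i j) : u = 1 := by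
  obtain ⟨φ, hφ, γ, h, hC, hPh⟩ := PP.subseq hc (fun k => D (-((k : ℝ) • s)) * g)
    (fun k => hg.D _)
  obtain ⟨t, ht⟩ : ∃ t : ℕ → HH n, t = fun k => (φ k : ℝ) • s := ⟨_, rfl⟩
  have hC1 : CV (fun k => D (-t k) * g * iota (γ k)) h := by rw [ht]; exact hC
  obtain ⟨b, γ1, hb⟩ := hM c hc g hg _ _ _ hC1
  have hu1 : CV (fun k => D (-t k) * u * D (t k)) 1 := by
    intro i j
    have he : ∀ k, (D (-t k) * u * D (t k)).1 i j =
        Real.exp (-((φ k : ℝ) * (s.1 i - s.1 j))) * u.1 i j := by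
      intro k
      have := conj_entry (-t k) u i j
      rw [neg_neg] at this
      rw [this, ht]
      congr 2
      simp
      ring
    simp_rw [he]
    by_cases hij : s.1 j < s.1 i
    · have hne : i ≠ j := by rintro rfl; exact lt_irrefl _ hij
      have h0 : Tendsto (fun k => Real.exp (-((φ k : ℝ) * (s.1 i - s.1 j)))) atTop (𝓝 0) := by
        apply Real.tendsto_exp_neg_atTop_nhds_zero.comp
        exact (tendsto_natCast_atTop_atTop.comp hφ.tendsto_atTop).atTop_mul_const (by linarith)
      have := h0.mul_const (u.1 i j)
      rw [zero_mul] at this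
      rw [Matrix.SpecialLinearGroup.coe_one, one_apply_ne hne]
      exact this
    · rw [hu i j hij, Matrix.SpecialLinearGroup.coe_one]
      by_cases hne : i = j
      · subst hne; simp
      · rw [one_apply_ne hne]; simp
  have hC2 : CV (fun k => D (-t k) * (u * g) * iota (γ k)) h := by
    have := hu1.mul hC1
    rw [one_mul] at this
    convert this using 2 with k
    have e : D (t k) * D (-t k) = 1 := by rw [← D_add, add_neg_cancel, D_zero]
    calc D (-t k) * (u * g) * iota (γ k) = D (-t k) * u * (D (t k) * D (-t k)) * g * iota (γ k) := by
          rw [e]; group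
      _ = _ := by group
  obtain ⟨b', γ2, hb'⟩ := hM c hc (u * g) hug _ _ _ hC2
  obtain ⟨b2, hb2⟩ : ∃ b2, b2 = -b' + b := ⟨_, rfl⟩
  obtain ⟨γ3, hγ3⟩ : ∃ γ3, γ3 = γ1 * γ2⁻¹ := ⟨_, rfl⟩
  have hug3 : u * g = D b2 * g * iota γ3 := by
    rw [hb2, hγ3, D_add, D_neg, map_mul, map_inv]
    have : u * g = (D b')⁻¹ * h * (iota γ2)⁻¹ := by rw [hb']; group
    rw [this, hb]; group
  have hC3 := (hC1.inv.mul (CV.const (D (-b2)))).mul hC2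
  have hC4 : CV (fun k => iota ((γ k)⁻¹ * γ3 * γ k)) (h⁻¹ * D (-b2) * h) := by
    convert hC3 using 2 with k
    rw [hug3, map_mul, map_mul, map_inv]
    have e : D (-t k) * D b2 = D b2 * D (-t k) := D_comm _ _
    calc _ = (iota (γ k))⁻¹ * g⁻¹ * (D (-t k))⁻¹ * (D b2)⁻¹ * (D b2 * D (-t k)) * g * iota γ3 * iota (γ k) := by
            group
      _ = _ := by rw [← e, D_neg b2]; group
  obtain ⟨σ, hσ⟩ := hC4.int
  obtain ⟨ρ, hρ⟩ : ∃ ρ, ρ = γ1 * σ * γ1⁻¹ := ⟨_, rfl⟩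
  have hρ1 : D (-b2) * g = g * iota ρ := by
    have e1 : D (-b2) * D b = D b * D (-b2) := D_comm _ _
    have e2 : D (-b2) * h = h * iota σ := by rw [← hσ]; group
    rw [hb] at e2
    rw [hρ, map_mul, map_mul, map_inv]
    calc D (-b2) * g = (D b)⁻¹ * (D b * D (-b2)) * g := by group
      _ = (D b)⁻¹ * (D (-b2) * (D b * g * iota γ1)) * (iota γ1)⁻¹ := by rw [← e1]; group
      _ = _ := by rw [e2]; group
  have hfin : u * g = g * iota (ρ⁻¹ * γ3) := by
    rw [hug3, map_mul, map_inv]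
    have : D b2 * g = g * (iota ρ)⁻¹ := by
      have : g = D b2 * (D (-b2) * g) := by rw [D_neg]; group
      rw [hρ1] at this
      calc D b2 * g = D b2 * (g * iota ρ) * (iota ρ)⁻¹ := by group
        _ = _ := by rw [← this]
    rw [this]; group
  have hEq : u * g = g := by
    apply lv_ext
    intro m
    obtain ⟨i, -, hi⟩ := Finset.exists_min_image Finset.univ s.1 ⟨0, Finset.mem_univ _⟩
    have hrow : lv (u * g) m i = lv g m i := by
      rw [lv_mul]
      have : (u.1 *ᵥ lv g m) i = ((1 : Matrix (Fin n) (Fin n) ℝ) *ᵥ lv g m) i := by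
        simp only [mulVec, dotProduct]
        refine Finset.sum_congr rfl fun j _ => ?_
        rw [hu i j (not_lt.2 (hi j (Finset.mem_univ _)))]
      rw [this, one_mulVec]
    by_cases hm : (ρ⁻¹ * γ3).1 *ᵥ m - m = 0
    · rw [hfin, lv_iota, sub_eq_zero.1 hm]
    · exfalso
      have h1 := hg _ hm
      have h2 : lv g ((ρ⁻¹ * γ3).1 *ᵥ m - m) i = 0 := by
        rw [lv_sub, ← lv_iota, ← hfin, Pi.sub_apply, hrow, sub_self]
      rw [Finset.prod_eq_zero (Finset.mem_univ i) h2, abs_zero] at h1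
      linarith
  exact mul_eq_right.1 hEq

end

noncomputable section
open Matrix Filter Topology

def FF {n : ℕ} (s : HH n) (h : SLd n) (τ : ℝ) : ℝ :=
  ∑ i, ∑ j, if s.1 j < s.1 i then |Real.exp (τ * (s.1 i - s.1 j)) * h.1 i j| else 0

lemma FF_cont {n : ℕ} (s : HH n) (h : SLd n) : Continuous (FF s h) := by
  unfold FF
  refine continuous_finsetSum _ fun i _ => continuous_finsetSum _ fun j _ => ?_
  split_ifs
  · fun_prop
  · fun_prop

lemma FF_le {n : ℕ} (s : HH n) (h : SLd n) (τ : ℝ) (i j : Fin n) (hij : s.1 j < s.1 i) :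
    |Real.exp (τ * (s.1 i - s.1 j)) * h.1 i j| ≤ FF s h τ := by
  unfold FF
  have h0 : ∀ i j, 0 ≤ (if s.1 j < s.1 i then |Real.exp (τ * (s.1 i - s.1 j)) * h.1 i j| else 0) := by
    intro i j
    split_ifs
    · exact abs_nonneg _
    · exact le_rfl
  calc _ = (if s.1 j < s.1 i then |Real.exp (τ * (s.1 i - s.1 j)) * h.1 i j| else 0) := by
        rw [if_pos hij]
    _ ≤ ∑ j, (if s.1 j < s.1 i then |Real.exp (τ * (s.1 i - s.1 j)) * h.1 i j| else 0) :=
        Finset.single_le_sum (f := fun j =>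
          (if s.1 j < s.1 i then |Real.exp (τ * (s.1 i - s.1 j)) * h.1 i j| else 0))
          (fun j _ => h0 i j) (Finset.mem_univ j)
    _ ≤ _ := Finset.single_le_sum (f := fun i => ∑ j,
          (if s.1 j < s.1 i then |Real.exp (τ * (s.1 i - s.1 j)) * h.1 i j| else 0))
          (fun i _ => Finset.sum_nonneg fun j _ => h0 i j) (Finset.mem_univ i)

lemma FF_ivt {n : ℕ} (s : HH n) (h : SLd n) (h0 : FF s h 0 < 1) (i j : Fin n)
    (hij : s.1 j < s.1 i) (hne : h.1 i j ≠ 0) : ∃ τ, 0 ≤ τ ∧ FF s h τ = 1 := by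
  have ht : Tendsto (fun τ : ℝ => Real.exp (τ * (s.1 i - s.1 j)) * |h.1 i j|) atTop atTop :=
    (Real.tendsto_exp_atTop.comp (tendsto_id.atTop_mul_const (by linarith))).atTop_mul_const
      (abs_pos.2 hne)
  obtain ⟨T, hT1, hT0⟩ := ((ht.eventually_ge_atTop 1).and (eventually_ge_atTop 0)).exists
  have hT : 1 ≤ FF s h T := by
    refine le_trans ?_ (FF_le s h T i j hij)
    rw [abs_mul, Real.abs_exp]
    exact hT1
  obtain ⟨τ, hτ, hτ1⟩ := intermediate_value_Icc hT0 (FF_cont s h).continuousOn ⟨h0.le, hT⟩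
  exact ⟨τ, hτ.1, hτ1⟩

theorem lemB {n : ℕ} [NeZero n] (hM : Mg n) {c : ℝ} (hc : 0 < c) (g : SLd n) (hg : PP c g)
    (h : ℕ → SLd n) (hh : CV h 1) (s : HH n)
    (H : ∀ φ : ℕ → ℕ, StrictMono φ → ∀ τ : ℕ → ℝ, (∀ k, 0 ≤ τ k) → ∀ (γ : ℕ → SZ n) (y : SLd n),
      CV (fun k => D (τ k • s) * h (φ k) * g * iota (γ k)) y → PP c y) :
    ∀ᶠ k in atTop, ∀ i j, s.1 j < s.1 i → (h k).1 i j = 0 := by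
  by_contra hcon
  have hF0 : Tendsto (fun k => FF s (h k) 0) atTop (𝓝 (FF s 1 0)) := by
    unfold FF
    refine tendsto_finsetSum _ fun i _ => tendsto_finsetSum _ fun j _ => ?_
    split_ifs
    · exact ((hh i j).const_mul _).abs
    · exact tendsto_const_nhds
  have hF1 : FF s 1 0 = 0 := by
    unfold FF
    refine Finset.sum_eq_zero fun i _ => Finset.sum_eq_zero fun j _ => ?_
    split_ifs with hij
    · have hne : i ≠ j := by rintro rfl; exact lt_irrefl _ hij
      rw [Matrix.SpecialLinearGroup.coe_one, one_apply_ne hne]; simp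
    · rfl
  rw [hF1] at hF0
  have hev1 : ∀ᶠ k in atTop, FF s (h k) 0 < 1 := hF0.eventually_lt_const one_pos
  have hev2 : ∀ᶠ k in atTop, ∀ i j, |(h k).1 i j| < 2 := by
    refine eventually_all.2 fun i => eventually_all.2 fun j => ?_
    refine (hh i j).abs.eventually_lt_const ?_
    rw [Matrix.SpecialLinearGroup.coe_one, one_apply]
    split_ifs <;> norm_num
  have hfr := (not_eventually.1 hcon).and_eventually (hev1.and hev2)
  obtain ⟨φ, hφ, hφP⟩ := extraction_of_frequently_atTop hfr
  have hτ : ∀ k, ∃ τ, 0 ≤ τ ∧ FF s (h (φ k)) τ = 1 := by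
    intro k
    obtain ⟨h1, h2, -⟩ := hφP k
    push Not at h1
    obtain ⟨i, j, hij, hne⟩ := h1
    exact FF_ivt s _ h2 i j hij hne
  choose τ hτ0 hτ1 using hτ
  obtain ⟨u, hu⟩ : ∃ u : ℕ → SLd n, u = fun k => D (τ k • s) * h (φ k) * D (-(τ k • s)) := ⟨_, rfl⟩
  have hue : ∀ k i j, (u k).1 i j = Real.exp (τ k * (s.1 i - s.1 j)) * (h (φ k)).1 i j := by
    intro k i j
    rw [hu]
    rw [conj_entry]
    congr 2
    simp; ring
  have hexp : ∀ k i j, ¬ s.1 j < s.1 i → |(u k).1 i j| ≤ |(h (φ k)).1 i j| := by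
    intro k i j hij
    rw [hue, abs_mul, Real.abs_exp]
    refine mul_le_of_le_one_left (abs_nonneg _) (Real.exp_le_one_iff.2 ?_)
    exact mul_nonpos_of_nonneg_of_nonpos (hτ0 k) (by linarith)
  obtain ⟨ψ, hψ, u0, hu0⟩ := CV.of_bdd (u := u) (C := 2) (by
    intro k i j
    by_cases hij : s.1 j < s.1 i
    · rw [hue]
      exact (FF_le s _ _ i j hij).trans (by rw [hτ1]; norm_num)
    · exact (hexp k i j hij).trans ((hφP k).2.2 i j).le)
  obtain ⟨χ, hχ, γ, y, hy, hPy⟩ := PP.subseq hc (fun k => D (τ (ψ k) • s) * g) (fun k => hg.D _)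
  have hPuy : PP c (u0 * y) := by
    refine H (fun k => φ (ψ (χ k))) (hφ.comp (hψ.comp hχ)) (fun k => τ (ψ (χ k)))
      (fun k => hτ0 _) γ _ ?_
    have := (hu0.comp hχ.tendsto_atTop).mul hy
    convert this using 2 with k
    rw [hu]
    simp only [D_neg]
    group
  have hu1 : u0 = 1 := by
    refine lemA hM hc y u0 hPy hPuy s fun i j hij => ?_
    have hlim := hu0 i j
    refine tendsto_nhds_unique hlim ?_
    have hh2 : Tendsto (fun k => (h (φ (ψ k))).1 i j) atTop
        (𝓝 ((1 : Matrix (Fin n) (Fin n) ℝ) i j)) :=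
      (hh i j).comp (hφ.comp hψ).tendsto_atTop
    by_cases hne : i = j
    · subst hne
      simpa [hue] using hh2
    · rw [one_apply_ne hne] at hh2 ⊢
      exact squeeze_zero_norm (fun k => hexp _ i j hij) (by simpa using hh2.abs)
  have hsum : Tendsto (fun k => FF s (h (φ (ψ k))) (τ (ψ k))) atTop (𝓝 (FF s 1 0)) := by
    unfold FF
    refine tendsto_finsetSum _ fun i _ => tendsto_finsetSum _ fun j _ => ?_
    split_ifs
    · have := (hu0 i j).abs
      simp only [hue, hu1] at this
      simpa using this
    · exact tendsto_const_nhds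
  simp only [hτ1, hF1] at hsum
  exact one_ne_zero (tendsto_nhds_unique tendsto_const_nhds hsum)

def root {n : ℕ} (i j : Fin n) : HH n :=
  ⟨Pi.single i 1 - Pi.single j 1, by
    change ∑ k, (Pi.single i (1:ℝ) - Pi.single j 1 : Fin n → ℝ) k = 0
    simp [Finset.sum_sub_distrib, Finset.sum_pi_single']⟩

lemma root_apply {n : ℕ} (i j k : Fin n) :
    (root i j).1 k = (if k = i then 1 else 0) - (if k = j then 1 else 0) := by
  simp [root, Pi.single_apply]

theorem lemB2 {n : ℕ} [NeZero n] (hM : Mg n) {c : ℝ} (hc : 0 < c) (g : SLd n) (hg : PP c g)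
    (h : ℕ → SLd n) (hh : CV h 1) (hP : ∀ k, PP c (h k * g)) :
    ∀ᶠ k in atTop, IsDiag (h k) := by
  have h1 : ∀ᶠ k in atTop, ∀ i, 0 < (h k).1 i i := by
    refine eventually_all.2 fun i => (hh i i).eventually_const_lt ?_
    simp
  have h2 : ∀ᶠ k in atTop, ∀ i j, i ≠ j → (h k).1 i j = 0 := by
    refine eventually_all.2 fun i => eventually_all.2 fun j => ?_
    by_cases hij : i = j
    · exact Eventually.of_forall fun k hk => absurd hij hk
    have := lemB hM hc g hg h hh (root i j) (by
      intro φ hφ τ hτ γ y hy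
      refine PP.lim hy (Eventually.of_forall fun k => ?_)
      rw [mul_assoc (D _)]
      exact ((hP _).D _).iota _)
    refine this.mono fun k hk _ => hk i j ?_
    rw [root_apply, root_apply]
    have hji : j ≠ i := fun h => hij h.symm
    simp [hij, hji]
  exact h1.and h2

theorem lemS {n : ℕ} [NeZero n] (hM : Mg n) {c : ℝ} (hc : 0 < c) (g : SLd n) (hg : PP c g) :
    ∃ R : ℝ, ∀ s : HH n, ∃ s' : HH n, (∃ σ : SZ n, D s' * g = g * iota σ) ∧
      ∀ i, |s.1 i - s'.1 i| ≤ R := by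
  by_contra hcon
  push Not at hcon
  choose s hs using fun k : ℕ => hcon (k : ℝ)
  obtain ⟨φ, hφ, γ, y, hy, hPy⟩ := PP.subseq hc (fun k => D (s k) * g) (fun k => hg.D _)
  obtain ⟨b, γ1, hb⟩ := hM c hc g hg _ _ _ hy
  obtain ⟨h, hh⟩ : ∃ h : ℕ → SLd n, h = fun k => D (-b) * (D (s (φ k)) * g * iota (γ k)) *
    ((iota γ1)⁻¹ * g⁻¹) := ⟨_, rfl⟩
  have hCV : CV h 1 := by
    have := ((CV.const (D (-b))).mul hy).mul (CV.const ((iota γ1)⁻¹ * g⁻¹))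
    rw [hh]
    convert this using 1
    rw [hb, D_neg]; group
  have hhg : ∀ k, h k * g = D (-b + s (φ k)) * g * iota (γ k * γ1⁻¹) := by
    intro k
    rw [hh, D_add, map_mul, map_inv]
    group
  have hdiag := lemB2 hM hc g hg h hCV (fun k => by rw [hhg]; exact (hg.D _).iota _)
  have hlog : ∀ᶠ k in atTop, ∀ i, |Real.log ((h k).1 i i)| < 1 := by
    refine eventually_all.2 fun i => ?_
    have : Tendsto (fun k => |Real.log ((h k).1 i i)|) atTop (𝓝 |Real.log 1|) := by
      refine Tendsto.abs ((Real.continuousAt_log one_ne_zero).tendsto.comp ?_)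
      simpa using hCV i i
    exact this.eventually_lt_const (by simp)
  obtain ⟨N, hN⟩ := exists_nat_ge (∑ i, |b.1 i| + 1)
  obtain ⟨k, ⟨hk1, hk2⟩, hkN⟩ := ((hdiag.and hlog).and (eventually_ge_atTop N)).exists
  obtain ⟨e, he, he'⟩ := diag_eq_D (h k) hk1
  obtain ⟨i, hi⟩ := hs (φ k) (-e + (-b + s (φ k))) ⟨(γ k * γ1⁻¹)⁻¹, by
    have := hhg k
    rw [he] at this
    rw [D_add, D_neg e, map_inv]
    calc (D e)⁻¹ * D (-b + s (φ k)) * g =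
        (D e)⁻¹ * (D (-b + s (φ k)) * g * iota (γ k * γ1⁻¹)) * (iota (γ k * γ1⁻¹))⁻¹ := by group
      _ = _ := by rw [← this]; group⟩
  have h1 : (s (φ k)).1 i - (-e + (-b + s (φ k))).1 i = b.1 i + e.1 i := by
    simp
    ring
  rw [h1] at hi
  have h2 : |b.1 i + e.1 i| ≤ |b.1 i| + |e.1 i| := abs_add_le _ _
  have h3 : |e.1 i| < 1 := by rw [he']; exact hk2 i
  have h4 : |b.1 i| ≤ ∑ i, |b.1 i| :=
    Finset.single_le_sum (f := fun i => |b.1 i|) (fun i _ => abs_nonneg _) (Finset.mem_univ i)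
  have h5 : (N : ℝ) ≤ φ k := by exact_mod_cast hkN.trans (hφ.id_le k)
  linarith

end

noncomputable section
open Matrix Filter Topology

def SS {n : ℕ} (g : SLd n) : AddSubgroup (HH n) where
  carrier := {s | ∃ σ : SZ n, D s * g = g * iota σ}
  add_mem' := by
    rintro a b ⟨σ, hσ⟩ ⟨ρ, hρ⟩
    refine ⟨σ * ρ, ?_⟩
    rw [D_add, mul_assoc, hρ, ← mul_assoc, hσ, map_mul, mul_assoc]
  zero_mem' := ⟨1, by rw [D_zero, map_one, one_mul, mul_one]⟩
  neg_mem' := by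
    rintro a ⟨σ, hσ⟩
    refine ⟨σ⁻¹, ?_⟩
    rw [D_neg, map_inv, inv_mul_eq_iff_eq_mul, ← mul_assoc, hσ]
    group

lemma mem_SS {n : ℕ} (g : SLd n) (s : HH n) : s ∈ SS g ↔ ∃ σ : SZ n, D s * g = g * iota σ :=
  Iff.rfl

def chi {n : ℕ} (i j : Fin n) : HH n →+ ℝ where
  toFun s := s.1 i - s.1 j
  map_zero' := by simp
  map_add' := by intro a b; simp; ring

lemma chi_apply {n : ℕ} (i j : Fin n) (s : HH n) : chi i j s = s.1 i - s.1 j := rfl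

lemma PP.ne {n : ℕ} {c : ℝ} {g : SLd n} (hc : 0 < c) (hg : PP c g) {m : Fin n → ℤ} (hm : m ≠ 0)
    (i : Fin n) : _root_.lv g m i ≠ 0 := by
  intro h
  have := hg m hm
  rw [Finset.prod_eq_zero (Finset.mem_univ i) h, abs_zero] at this
  linarith

lemma lv_pow {n : ℕ} {g : SLd n} {s : HH n} {σ : SZ n} (h : D s * g = g * iota σ) (k : ℕ)
    (m : Fin n → ℤ) (i : Fin n) :
    lv g ((σ.1 ^ k) *ᵥ m) i = Real.exp (s.1 i) ^ k * lv g m i := by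
  induction k generalizing m with
  | zero => simp
  | succ k ih =>
    rw [pow_succ, ← mulVec_mulVec, ih, ← lv_iota, ← h, lv_D, pow_succ, mul_assoc]

lemma lv_add {n : ℕ} (g : SLd n) (m m' : Fin n → ℤ) : lv g (m + m') = lv g m + lv g m' := by
  have : ic (m + m') = ic m + ic m' := by ext; simp [ic]
  rw [lv, this, mulVec_add]; rfl

lemma lv_smul {n : ℕ} (g : SLd n) (a : ℤ) (m : Fin n → ℤ) : lv g (a • m) = (a : ℝ) • lv g m := by
  have : ic (a • m) = (a : ℝ) • ic m := by ext; simp [ic]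
  rw [lv, this, mulVec_smul]; rfl

lemma lv_poly {n : ℕ} {g : SLd n} {s : HH n} {σ : SZ n} (h : D s * g = g * iota σ)
    (P : Polynomial ℤ) (m : Fin n → ℤ) (i : Fin n) :
    lv g ((Polynomial.aeval σ.1 P) *ᵥ m) i =
      (P.map (Int.castRingHom ℝ)).eval (Real.exp (s.1 i)) * lv g m i := by
  induction P using Polynomial.induction_on' with
  | add p q hp hq =>
    rw [map_add, add_mulVec, lv_add, Pi.add_apply, hp, hq, Polynomial.map_add, Polynomial.eval_add,
      add_mul]
  | monomial k a =>
    rw [Polynomial.aeval_monomial, ← Algebra.smul_def, smul_mulVec, lv_smul, Pi.smul_apply,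
      lv_pow h, Polynomial.map_monomial, Polynomial.eval_monomial, smul_eq_mul, mul_assoc]
    rfl

lemma charpoly_eq {n : ℕ} {g : SLd n} {s : HH n} {σ : SZ n} (h : D s * g = g * iota σ) :
    σ.1.charpoly.map (Int.castRingHom ℝ) =
      ∏ i, (Polynomial.X - Polynomial.C (Real.exp (s.1 i))) := by
  have h1 : (iota σ).1 = σ.1.map (Int.castRingHom ℝ) := by ext i j; rw [iota_apply]; rfl
  rw [← Matrix.charpoly_map, ← h1]
  have h2 : iota σ = g⁻¹ * (D s * g) := by rw [h]; group
  rw [h2, Matrix.SpecialLinearGroup.coe_mul, Matrix.charpoly_mul_comm,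
    ← Matrix.SpecialLinearGroup.coe_mul]
  have h3 : D s * g * g⁻¹ = D s := by group
  rw [h3]
  exact Matrix.charpoly_diagonal _

lemma deriv_root {n : ℕ} (a : Fin n → ℝ) (j : Fin n) :
    (Polynomial.derivative (∏ i, (Polynomial.X - Polynomial.C (a i)))).eval (a j) =
      ∏ i ∈ Finset.univ.erase j, (a j - a i) := by
  rw [← Finset.mul_prod_erase _ _ (Finset.mem_univ j), Polynomial.derivative_mul]
  simp [Polynomial.eval_prod]

theorem no_dom {n : ℕ} {c : ℝ} (hc : 0 < c) {g : SLd n} (hg : PP c g)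
    {s : HH n} (hs : s ∈ SS g) {i0 l j : Fin n} (h1 : i0 ≠ l) (h3 : s.1 i0 = s.1 l)
    (h4 : ∀ i, i ≠ j → s.1 i < s.1 j) : False := by
  obtain ⟨σ, hσ⟩ := hs
  have hP := lv_poly hσ (Polynomial.derivative σ.1.charpoly)
  rw [← Polynomial.derivative_map, charpoly_eq hσ] at hP
  have hm : (Pi.single j 1 : Fin n → ℤ) ≠ 0 := by simp
  obtain ⟨m, hm⟩ : ∃ m : Fin n → ℤ, m ≠ 0 := ⟨_, hm⟩
  have hi0 := hP m i0
  rw [deriv_root (fun i => Real.exp (s.1 i)), Finset.prod_eq_zero (i := l)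
    (Finset.mem_erase.2 ⟨h1.symm, Finset.mem_univ _⟩) (by rw [h3, sub_self]), zero_mul] at hi0
  have hz : (Polynomial.aeval σ.1 (Polynomial.derivative σ.1.charpoly)) *ᵥ m = 0 := by
    by_contra hne
    exact hg.ne hc hne i0 hi0
  have hj := hP m j
  rw [hz, deriv_root (fun i => Real.exp (s.1 i))] at hj
  have h0 : lv g 0 j = 0 := by
    have : ic (0 : Fin n → ℤ) = 0 := by ext; simp [ic]
    rw [lv, this, mulVec_zero]; rfl
  rw [h0, eq_comm, mul_eq_zero] at hj
  rcases hj with hj | hj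
  · rw [Finset.prod_eq_zero_iff] at hj
    obtain ⟨i, hi, hi2⟩ := hj
    have := Real.exp_lt_exp.2 (h4 i (Finset.mem_erase.1 hi).1)
    linarith
  · exact hg.ne hc hm j hj

lemma approx {n : ℕ} (g : SLd n) : ∃ C : ℝ, 0 ≤ C ∧ ∀ y : Fin n → ℝ, ∃ m : Fin n → ℤ,
    ∀ i, |lv g m i - y i| ≤ C := by
  refine ⟨∑ i, ∑ j, |g.1 i j|, by positivity, fun y => ?_⟩
  refine ⟨fun j => round (((g⁻¹).1 *ᵥ y) j), fun i => ?_⟩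
  obtain ⟨z, hz⟩ : ∃ z, z = (g⁻¹).1 *ᵥ y := ⟨_, rfl⟩
  have hy : y = g.1 *ᵥ z := by
    rw [hz, mulVec_mulVec, ← Matrix.SpecialLinearGroup.coe_mul, mul_inv_cancel,
      Matrix.SpecialLinearGroup.coe_one, one_mulVec]
  rw [← hz, hy, lv, ← Pi.sub_apply, ← mulVec_sub]
  simp only [mulVec, dotProduct]
  refine (Finset.abs_sum_le_sum_abs _ _).trans ?_
  refine le_trans ?_ (Finset.single_le_sum (f := fun i => ∑ j, |g.1 i j|)
    (fun i _ => Finset.sum_nonneg fun j _ => abs_nonneg _) (Finset.mem_univ i))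
  refine Finset.sum_le_sum fun j _ => ?_
  rw [abs_mul]
  refine mul_le_of_le_one_right (abs_nonneg _) ?_
  rw [Pi.sub_apply, abs_sub_comm]
  exact (abs_sub_round _).trans (by norm_num)

lemma orthant {n : ℕ} (g : SLd n) {i l : Fin n} (hil : i ≠ l) {a b : ℝ} (ha : a ≠ 0) (hb : b ≠ 0) :
    ∃ m : Fin n → ℤ, 0 < a * lv g m i ∧ b * lv g m l < 0 := by
  obtain ⟨C, hC0, hC⟩ := approx g
  obtain ⟨X, hX⟩ : ∃ X : ℝ, X = (C + 1) / |a| + (C + 1) / |b| := ⟨_, rfl⟩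
  have ha' := abs_pos.2 ha
  have hb' := abs_pos.2 hb
  have hXa : C + 1 ≤ X * |a| := by
    rw [hX, add_mul, div_mul_cancel₀ _ ha'.ne']
    have : 0 ≤ (C + 1) / |b| * |a| := by positivity
    linarith
  have hXb : C + 1 ≤ X * |b| := by
    rw [hX, add_mul, div_mul_cancel₀ _ hb'.ne']
    have : 0 ≤ (C + 1) / |a| * |b| := by positivity
    linarith
  obtain ⟨m, hm⟩ := hC (Pi.single i (X * a) - Pi.single l (X * b))
  have h1 := hm i
  have h2 := hm l
  simp only [Pi.sub_apply, Pi.single_eq_same, Pi.single_eq_of_ne hil, Pi.single_eq_of_ne hil.symm,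
    sub_zero, zero_sub] at h1 h2
  have h1' : |a * (lv g m i - X * a)| ≤ |a| * C := by
    rw [abs_mul]; exact mul_le_mul_of_nonneg_left h1 ha'.le
  have h2' : |b * (lv g m l - -(X * b))| ≤ |b| * C := by
    rw [abs_mul]; exact mul_le_mul_of_nonneg_left h2 hb'.le
  have e1 := abs_mul_abs_self a
  have e2 := abs_mul_abs_self b
  refine ⟨m, ?_, ?_⟩
  · have := (abs_le.1 h1').1
    nlinarith
  · have := (abs_le.1 h2').2
    nlinarith

def dirq {n : ℕ} (w : Fin n → ℝ) : HH n :=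
  ⟨fun i => n * w i - ∑ j, w j, by
    change ∑ i, (n * w i - ∑ j, w j) = 0
    rw [Finset.sum_sub_distrib, ← Finset.mul_sum]
    simp⟩

lemma dirq_apply {n : ℕ} (w : Fin n → ℝ) (i : Fin n) : (dirq w).1 i = n * w i - ∑ j, w j := rfl

lemma seqS {n : ℕ} [NeZero n] (hM : Mg n) {c : ℝ} (hc : 0 < c) (g : SLd n) (hg : PP c g)
    (q : HH n) (i l : Fin n) (hq : q.1 i = q.1 l) :
    ∃ (R : ℝ) (s : ℕ → HH n) (t : ℕ → ℝ) (x : ℝ), (∀ k, s k ∈ SS g) ∧ Tendsto t atTop atTop ∧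
      (∀ k i, |t k * q.1 i - (s k).1 i| ≤ R) ∧ Tendsto (fun k => chi i l (s k)) atTop (𝓝 x) := by
  obtain ⟨R, hR⟩ := lemS hM hc g hg
  choose s hs1 hs2 using fun k : ℕ => hR ((k : ℝ) • q)
  have hs3 : ∀ (k : ℕ) i, |(k : ℝ) * q.1 i - (s k).1 i| ≤ R := fun k i => hs2 k i
  obtain ⟨x, -, φ, hφ, hx⟩ := (isCompact_Icc (a := -(2 * R)) (b := 2 * R)).tendsto_subseq
    (x := fun k => chi i l (s k)) (by
      intro k
      have h1 := abs_le.1 (hs3 k i)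
      have h2 := abs_le.1 (hs3 k l)
      rw [chi_apply]
      rw [hq] at h1
      constructor <;> linarith [h1.1, h1.2, h2.1, h2.2])
  exact ⟨R, fun k => s (φ k), fun k => (φ k : ℝ), x, fun k => hs1 _,
    tendsto_natCast_atTop_atTop.comp hφ.tendsto_atTop, fun k i => hs3 _ i, hx⟩

theorem F_cyclic {n : ℕ} [NeZero n] (hM : Mg n) {c : ℝ} (hc : 0 < c) (g : SLd n) (hg : PP c g)
    {i0 l j : Fin n} (h1 : i0 ≠ l) (h2 : j ≠ i0) (h3 : j ≠ l) (a : ℝ)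
    (ha : (SS g).map (chi i0 l) = AddSubgroup.closure {a}) : False := by
  have hn : (0 : ℝ) < n := by exact_mod_cast Nat.pos_of_ne_zero (NeZero.ne n)
  obtain ⟨q, hq⟩ : ∃ q : HH n, q = dirq (Pi.single j 1) := ⟨_, rfl⟩
  have hqj : q.1 j = n - 1 := by rw [hq, dirq_apply]; simp
  have hqi : ∀ i, i ≠ j → q.1 i = -1 := by
    intro i hi
    rw [hq, dirq_apply]; simp [hi]
  obtain ⟨R, s, t, x, hs, ht, hst, hx⟩ := seqS hM hc g hg q i0 l
    (by rw [hqi _ h2.symm, hqi _ h3.symm])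
  have hmem : ∀ k, ∃ z : ℤ, chi i0 l (s k) = z * a := by
    intro k
    have : chi i0 l (s k) ∈ (SS g).map (chi i0 l) := ⟨_, hs k, rfl⟩
    rw [ha, AddSubgroup.mem_closure_singleton] at this
    obtain ⟨z, hz⟩ := this
    exact ⟨z, by rw [← hz]; simp⟩
  choose z hz using hmem
  have heq : ∃ N, ∀ k ≥ N, chi i0 l (s k) = chi i0 l (s N) := by
    by_cases ha0 : a = 0
    · exact ⟨0, fun k _ => by rw [hz, hz, ha0]; simp⟩
    obtain ⟨N, hN⟩ := Metric.cauchySeq_iff'.1 hx.cauchySeq |a| (abs_pos.2 ha0)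
    refine ⟨N, fun k hk => ?_⟩
    have := hN k hk
    rw [Real.dist_eq, hz, hz, ← sub_mul, abs_mul] at this
    have h5 : |((z k - z N : ℤ) : ℝ)| < 1 := by
      push_cast
      by_contra hcon
      push Not at hcon
      nlinarith [abs_pos.2 ha0]
    have h6 : |z k - z N| < 1 := by exact_mod_cast h5
    have h7 := Int.abs_lt_one_iff.1 h6
    rw [hz, hz, sub_eq_zero.1 h7]
  obtain ⟨N, hN⟩ := heq
  obtain ⟨k, hk, hkN⟩ := ((ht.eventually_gt_atTop (t N + (4 * R + 1) / n)).and
    (eventually_ge_atTop N)).exists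
  have hk' : 4 * R + 1 < (t k - t N) * n := by
    rw [← div_lt_iff₀ hn]; linarith
  refine no_dom hc hg (s := s k - s N) (sub_mem (hs k) (hs N)) (i0 := i0) (l := l) (j := j) h1 ?_ ?_
  · have := hN k hkN
    rw [chi_apply, chi_apply] at this
    simp only [Submodule.coe_sub, Pi.sub_apply]
    linarith
  · intro i hi
    simp only [Submodule.coe_sub, Pi.sub_apply]
    have e1 := abs_le.1 (hst k i)
    have e2 := abs_le.1 (hst k j)
    have e3 := abs_le.1 (hst N i)
    have e4 := abs_le.1 (hst N j)
    rw [hqi i hi] at e1 e3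
    rw [hqj] at e2 e4
    linarith [e1.1, e1.2, e2.1, e2.2, e3.1, e3.2, e4.1, e4.2]

theorem F_dense {n : ℕ} [NeZero n] (hM : Mg n) {c : ℝ} (hc : 0 < c) (g : SLd n) (hg : PP c g)
    {i0 l : Fin n} (h1 : i0 ≠ l) (w : Fin n → ℝ) (hwl : w l ≠ 0) (hw0 : w i0 ≠ 0)
    {c1 : ℝ} (hc1 : 0 < c1)
    (H : ∀ m : Fin n → ℤ, ∑ j, w j * lv g m j ≠ 0 →
      c1 ≤ (∏ i ∈ Finset.univ.erase l, |lv g m i|) * |∑ j, w j * lv g m j|)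
    (hd : Dense (((SS g).map (chi i0 l) : AddSubgroup ℝ) : Set ℝ)) : False := by
  have hn : (0 : ℝ) < n := by exact_mod_cast Nat.pos_of_ne_zero (NeZero.ne n)
  obtain ⟨m, hm1, hm2⟩ := orthant g h1 hw0 hwl
  obtain ⟨p, hp⟩ : ∃ p, p = lv g m := ⟨_, rfl⟩
  rw [← hp] at hm1 hm2
  have hm0 : m ≠ 0 := by
    rintro rfl
    have : ic (0 : Fin n → ℤ) = 0 := by ext; simp [ic]
    rw [hp, lv, this, mulVec_zero] at hm1
    simp at hm1
  obtain ⟨q, hq⟩ : ∃ q : HH n, q = dirq (Pi.single i0 1 + Pi.single l 1) := ⟨_, rfl⟩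
  have hql : q.1 l = n - 2 := by
    rw [hq, dirq_apply]; simp [h1.symm, Finset.sum_add_distrib]; norm_num
  have hq0 : q.1 i0 = n - 2 := by
    rw [hq, dirq_apply]; simp [h1, Finset.sum_add_distrib]; norm_num
  have hqi : ∀ i, i ≠ i0 → i ≠ l → q.1 i = -2 := by
    intro i hi hi'
    rw [hq, dirq_apply]; simp [hi, hi', Finset.sum_add_distrib]; norm_num
  obtain ⟨R, s, t, x, hs, ht, hst, hx⟩ := seqS hM hc g hg q i0 l (by rw [hq0, hql])
  obtain ⟨P, hP⟩ : ∃ P, P = ∏ i ∈ Finset.univ.erase l, |p i| := ⟨_, rfl⟩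
  obtain ⟨r, hr⟩ : ∃ r, r = Real.log (-(w l * p l) / (w i0 * p i0)) := ⟨_, rfl⟩
  have hr' : w i0 * p i0 * Real.exp r = -(w l * p l) := by
    rw [hr, Real.exp_log (div_pos (by linarith) hm1), mul_div_cancel₀ _ hm1.ne']
  obtain ⟨f, hf⟩ : ∃ f : ℝ → ℝ, f = fun z => w l * p l + w i0 * p i0 * Real.exp z := ⟨_, rfl⟩
  have hfc : Continuous f := by rw [hf]; fun_prop
  have hfr : f r = 0 := by rw [hf]; simp only; rw [hr']; ring
  have hfne : ∀ z, z ≠ r → f z ≠ 0 := by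
    intro z hz h0
    have : w i0 * p i0 * Real.exp z = w i0 * p i0 * Real.exp r := by
      rw [hf] at h0; simp only at h0; rw [hr']; linarith
    exact hz (Real.exp_injective (mul_left_cancel₀ hm1.ne' this))
  have hne : ((fun z => z + x) ⁻¹' ({z | P * |f z| < c1} ∩ {r}ᶜ)).Nonempty := by
    have hmem : {z | P * |f z| < c1} ∈ 𝓝 r := by
      refine (isOpen_lt (by fun_prop) continuous_const).mem_nhds ?_
      simp [hfr, hc1]
    have hmem2 : {z | P * |f z| < c1} ∩ {r}ᶜ ∈ 𝓝[≠] r :=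
      inter_mem (mem_nhdsWithin_of_mem_nhds hmem) self_mem_nhdsWithin
    obtain ⟨z, hz⟩ := (NormedField.nhdsNE_neBot r).nonempty_of_mem hmem2
    exact ⟨z - x, by rw [Set.mem_preimage, sub_add_cancel]; exact hz⟩
  have hopen : IsOpen ((fun z => z + x) ⁻¹' ({z | P * |f z| < c1} ∩ {r}ᶜ)) :=
    ((isOpen_lt (by fun_prop) continuous_const).inter isOpen_compl_singleton).preimage (by fun_prop)
  obtain ⟨y, ⟨e, he, hey⟩, hy1, hy2⟩ := hd.exists_mem_open hopen hne
  have hy1' : P * |f (y + x)| < c1 := hy1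
  have hy2' : y + x ≠ r := hy2
  -- the sequence
  have hlim : Tendsto (fun k => ∑ j, w j * (Real.exp ((s k + e).1 j - (s k + e).1 l) * p j))
      atTop (𝓝 (f (y + x))) := by
    have hfe : f (y + x) = ∑ j, (if j = l then w l * p l else 0) +
        ∑ j, (if j = i0 then w i0 * p i0 * Real.exp (y + x) else 0) := by
      rw [hf]; simp
    rw [hfe, ← Finset.sum_add_distrib]
    refine tendsto_finsetSum _ fun j _ => ?_
    by_cases hjl : j = l
    · subst hjl
      simp [h1.symm]
    by_cases hj0 : j = i0
    · subst hj0
      simp only [if_neg h1, if_true, zero_add]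
      have hz : Tendsto (fun k => (s k + e).1 j - (s k + e).1 l) atTop (𝓝 (y + x)) := by
        have := hx.const_add y
        refine this.congr fun k => ?_
        rw [← hey, chi_apply, chi_apply]
        simp; ring
      have := ((Real.continuous_exp.tendsto _).comp hz).const_mul (w j * p j)
      refine this.congr fun k => ?_
      simp only [Function.comp]; ring
    · simp only [if_neg hjl, if_neg hj0, add_zero]
      have hz : Tendsto (fun k => (s k + e).1 j - (s k + e).1 l) atTop atBot := by
        have hb : Tendsto (fun k => -(t k * n) + (2 * R + e.1 j - e.1 l)) atTop atBot :=
          tendsto_atBot_add_const_right _ _ (tendsto_neg_atTop_atBot.comp (ht.atTop_mul_const hn))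
        refine tendsto_atBot_mono (fun k => ?_) hb
        have e1 := abs_le.1 (hst k j)
        have e2 := abs_le.1 (hst k l)
        rw [hqi j hj0 hjl] at e1
        rw [hql] at e2
        simp only [Submodule.coe_add, Pi.add_apply]
        linarith [e1.1, e1.2, e2.1, e2.2]
      have := ((Real.tendsto_exp_atBot.comp hz).mul_const (p j)).const_mul (w j)
      simpa using this
  have hev1 := hlim.eventually_ne (hfne _ hy2')
  have hev2 := (hlim.abs.const_mul P).eventually_lt_const hy1'
  obtain ⟨k, hk1, hk2⟩ := (hev1.and hev2).exists
  obtain ⟨S, hS⟩ : ∃ S, S = s k + e := ⟨_, rfl⟩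
  rw [← hS] at hk1 hk2
  obtain ⟨σ, hσ⟩ : S ∈ SS g := by rw [hS]; exact add_mem (hs k) he
  have hv : ∀ i, lv g (σ.1 *ᵥ m) i = Real.exp (S.1 i) * p i := by
    intro i
    rw [← lv_iota, ← hσ, lv_D, hp]
  have hsum : ∑ j, w j * lv g (σ.1 *ᵥ m) j =
      Real.exp (S.1 l) * ∑ j, w j * (Real.exp (S.1 j - S.1 l) * p j) := by
    rw [Finset.mul_sum]
    refine Finset.sum_congr rfl fun j _ => ?_
    rw [hv, Real.exp_sub]
    field_simp
  have hprod : (∏ i ∈ Finset.univ.erase l, |lv g (σ.1 *ᵥ m) i|) * Real.exp (S.1 l) = P := by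
    simp only [hv, abs_mul, Real.abs_exp, Finset.prod_mul_distrib]
    rw [← hP, mul_right_comm, mul_comm (∏ i ∈ _, _),
      Finset.mul_prod_erase _ (fun i => Real.exp (S.1 i)) (Finset.mem_univ l), ← Real.exp_sum,
      HH_sum, Real.exp_zero, one_mul]
  have hfin := H (σ.1 *ᵥ m) (by
    rw [hsum]; exact mul_ne_zero (Real.exp_pos _).ne' hk1)
  rw [hsum, abs_mul, Real.abs_exp, ← mul_assoc, hprod] at hfin
  linarith

theorem lemF {n : ℕ} [NeZero n] (hM : Mg n) {c : ℝ} (hc : 0 < c) (g : SLd n) (hg : PP c g)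
    {i0 l j : Fin n} (h1 : i0 ≠ l) (h2 : j ≠ i0) (h3 : j ≠ l)
    (w : Fin n → ℝ) (hwl : w l ≠ 0) (hw0 : w i0 ≠ 0)
    {c1 : ℝ} (hc1 : 0 < c1)
    (H : ∀ m : Fin n → ℤ, ∑ j, w j * lv g m j ≠ 0 →
      c1 ≤ (∏ i ∈ Finset.univ.erase l, |lv g m i|) * |∑ j, w j * lv g m j|) : False := by
  rcases AddSubgroup.dense_or_cyclic ((SS g).map (chi i0 l)) with hd | ⟨a, ha⟩
  · exact F_dense hM hc g hg h1 w hwl hw0 hc1 H hd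
  · exact F_cyclic hM hc g hg h1 h2 h3 a ha

end

noncomputable section
open Matrix Filter Topology

def ZZ {d : ℕ} (g : SLd d) (v : Fin d → ℝ) : SLd (d + 1) :=
  ⟨(Matrix.fromBlocks g.1 (Matrix.of fun i (_ : Fin 1) => v i) 0 1).submatrix
    finSumFinEquiv.symm finSumFinEquiv.symm, by
      rw [Matrix.det_submatrix_equiv_self, Matrix.det_fromBlocks_zero₂₁, g.2, det_one, one_mul]⟩

lemma symm_castSucc {d : ℕ} (i : Fin d) :
    (finSumFinEquiv.symm i.castSucc : Fin d ⊕ Fin 1) = Sum.inl i :=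
  finSumFinEquiv_symm_apply_castAdd i

lemma lv_ZZ_cast {d : ℕ} (g : SLd d) (v : Fin d → ℝ) (m : Fin (d + 1) → ℤ) (i : Fin d) :
    lv (ZZ g v) m i.castSucc =
      lv g (fun j => m j.castSucc) i + (m (Fin.last d) : ℝ) * v i := by
  simp only [lv, mulVec, dotProduct, ic, ZZ]
  rw [Fin.sum_univ_castSucc]
  simp only [submatrix_apply, symm_castSucc, finSumFinEquiv_symm_last]
  simp [mul_comm]

lemma lv_ZZ_last {d : ℕ} (g : SLd d) (v : Fin d → ℝ) (m : Fin (d + 1) → ℤ) :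
    lv (ZZ g v) m (Fin.last d) = (m (Fin.last d) : ℝ) := by
  simp only [lv, mulVec, dotProduct, ic, ZZ]
  rw [Fin.sum_univ_castSucc]
  simp only [submatrix_apply, symm_castSucc, finSumFinEquiv_symm_last]
  simp

lemma prod_D {n : ℕ} (t : HH n) (g : SLd n) (m : Fin n → ℤ) :
    ∏ i, lv (D t * g) m i = ∏ i, lv g m i := by
  simp only [lv_D, Finset.prod_mul_distrib]
  rw [← Real.exp_sum, HH_sum, Real.exp_zero, one_mul]

def HL {d : ℕ} (c : ℝ) (g : SLd d) (v : Fin d → ℝ) : Prop :=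
  ∀ (N : ℤ) (m : Fin d → ℤ), N ≠ 0 → c ≤ |(N : ℝ)| * |∏ i, (lv g m i + (N : ℝ) * v i)|

lemma HL.prod {d : ℕ} {c : ℝ} {g : SLd d} {v : Fin d → ℝ} (h : HL c g v) (m : Fin (d + 1) → ℤ)
    (hm : m (Fin.last d) ≠ 0) : c ≤ |∏ i, lv (ZZ g v) m i| := by
  rw [Fin.prod_univ_castSucc, lv_ZZ_last, abs_mul, mul_comm]
  simp only [lv_ZZ_cast]
  exact h _ _ hm

lemma SV_exists {n : ℕ} (g : SLd n) : ∃ δ : ℝ, 0 < δ ∧ SV δ g := by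
  obtain ⟨B, hB⟩ : ∃ B, B = ∑ i, ∑ j, |(g⁻¹).1 i j| := ⟨_, rfl⟩
  have hB0 : 0 ≤ B := by rw [hB]; positivity
  refine ⟨1 / (B + 1), by positivity, fun m hm => ?_⟩
  by_contra hcon
  push Not at hcon
  apply hm
  ext j
  have h1 : ic m = (g⁻¹).1 *ᵥ lv g m := by
    rw [lv, mulVec_mulVec, ← Matrix.SpecialLinearGroup.coe_mul, inv_mul_cancel,
      Matrix.SpecialLinearGroup.coe_one, one_mulVec]
  have h2 : |(m j : ℝ)| ≤ B * (1 / (B + 1)) := by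
    have : (m j : ℝ) = ((g⁻¹).1 *ᵥ lv g m) j := by rw [← h1]; rfl
    rw [this]
    simp only [mulVec, dotProduct]
    refine (Finset.abs_sum_le_sum_abs _ _).trans ?_
    calc ∑ i, |(g⁻¹).1 j i * lv g m i| ≤ ∑ i, |(g⁻¹).1 j i| * (1 / (B + 1)) := by
          refine Finset.sum_le_sum fun i _ => ?_
          rw [abs_mul]
          exact mul_le_mul_of_nonneg_left (hcon i).le (abs_nonneg _)
      _ = (∑ i, |(g⁻¹).1 j i|) * (1 / (B + 1)) := by rw [Finset.sum_mul]
      _ ≤ _ := by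
          refine mul_le_mul_of_nonneg_right ?_ (by positivity)
          rw [hB]
          exact Finset.single_le_sum (f := fun i => ∑ j, |(g⁻¹).1 i j|)
            (fun i _ => Finset.sum_nonneg fun j _ => abs_nonneg _) (Finset.mem_univ j)
  have h3 : B * (1 / (B + 1)) < 1 := by
    rw [mul_one_div, div_lt_one (by linarith)]; linarith
  have h4 : |m j| < 1 := by exact_mod_cast h2.trans_lt h3
  exact Int.abs_lt_one_iff.1 h4

lemma big_of_prod {n : ℕ} [NeZero n] {c : ℝ} (hc1 : c ≤ 1) (x : Fin n → ℝ) (h : c ≤ |∏ i, x i|) :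
    ∃ i, c ≤ |x i| := by
  by_contra hcon
  push Not at hcon
  rw [Finset.abs_prod, ← Finset.mul_prod_erase _ _ (Finset.mem_univ (0 : Fin n))] at h
  have h2 : |x 0| * ∏ i ∈ Finset.univ.erase 0, |x i| ≤ |x 0| := by
    refine mul_le_of_le_one_right (abs_nonneg _)
      (Finset.prod_le_one (fun i _ => abs_nonneg _) fun i _ => ?_)
    exact (hcon i).le.trans hc1
  linarith [hcon 0]

lemma cast_ne {d : ℕ} {m : Fin (d + 1) → ℤ} (hm : m ≠ 0) (h : m (Fin.last d) = 0) :
    (fun j : Fin d => m j.castSucc) ≠ 0 := by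
  intro h0
  apply hm
  ext j
  refine Fin.lastCases ?_ (fun i => ?_) j
  · simpa using h
  · exact congrFun h0 i

theorem lemC {d : ℕ} {c : ℝ} {g : SLd d} {v : Fin d → ℝ} (h : HL c g v)
    (t : ℕ → HH (d + 1)) (ht : ∀ i : Fin d, Tendsto (fun k => (t k).1 i.castSucc) atTop atTop)
    (γ : ℕ → SZ (d + 1)) (y : SLd (d + 1)) (hy : CV (fun k => D (t k) * ZZ g v * iota (γ k)) y) :
    PP c y := by
  obtain ⟨δ, hδ, hSV⟩ := SV_exists g
  intro m hm
  have hP : Tendsto (fun k => |∏ i, lv (D (t k) * ZZ g v * iota (γ k)) m i|) atTop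
      (𝓝 |∏ i, lv y m i|) := (tendsto_finsetProd _ fun i _ => hy.lv m i).abs
  refine ge_of_tendsto hP ?_
  have e1 : ∀ᶠ k in atTop, ∀ i, |lv (D (t k) * ZZ g v * iota (γ k)) m i| < |lv y m i| + 1 :=
    eventually_all.2 fun i => (hy.lv m i).abs.eventually_lt_const (by linarith)
  have e2 : ∀ᶠ k in atTop, ∀ i : Fin d,
      |lv y m i.castSucc| + 1 ≤ Real.exp ((t k).1 i.castSucc) * δ :=
    eventually_all.2 fun i => ((Real.tendsto_exp_atTop.comp (ht i)).atTop_mul_const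
      hδ).eventually_ge_atTop _
  filter_upwards [e1, e2] with k h1 h2
  rw [lv_iota, prod_D]
  apply h.prod
  intro h0
  obtain ⟨i, hi⟩ := hSV _ (cast_ne (gamma_ne (γ k) m hm) h0)
  have h3 := h1 i.castSucc
  have h4 := h2 i
  rw [lv_iota, lv_D, lv_ZZ_cast, h0, Int.cast_zero, zero_mul, add_zero, abs_mul, Real.abs_exp] at h3
  have := mul_le_mul_of_nonneg_left hi (Real.exp_pos ((t k).1 i.castSucc)).le
  linarith

theorem main_aux {d : ℕ} (hd : 2 ≤ d) (hM : Mg (d + 1)) {c : ℝ} (hc : 0 < c) (hc1 : c ≤ 1)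
    (g0 : SLd d) (v : Fin d → ℝ) (h : HL c g0 v) : False := by
  obtain ⟨δ, hδ, hSV⟩ := SV_exists g0
  obtain ⟨q, hq⟩ : ∃ q : HH (d + 1), q = -dirq (Pi.single (Fin.last d) 1) := ⟨_, rfl⟩
  have hqc : ∀ i : Fin d, q.1 i.castSucc = 1 := by
    intro i
    rw [hq]
    simp only [Submodule.coe_neg, Pi.neg_apply, dirq_apply]
    simp [Fin.castSucc_ne_last]
  have hmin : 0 < min c δ := lt_min hc hδ
  obtain ⟨φ, hφ, γ, g, hg⟩ := SV.subseq hmin (fun k => D ((k : ℝ) • q) * ZZ g0 v) (by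
    intro k m hm
    by_cases h0 : m (Fin.last d) = 0
    · obtain ⟨i, hi⟩ := hSV _ (cast_ne hm h0)
      refine ⟨i.castSucc, (min_le_right _ _).trans (hi.trans ?_)⟩
      rw [lv_D, lv_ZZ_cast, h0, Int.cast_zero, zero_mul, add_zero, abs_mul, Real.abs_exp]
      refine le_mul_of_one_le_left (abs_nonneg _) (Real.one_le_exp ?_)
      simp [hqc]
    · have := h.prod m h0
      rw [← prod_D ((k : ℝ) • q)] at this
      obtain ⟨i, hi⟩ := big_of_prod hc1 _ this
      exact ⟨i, (min_le_left _ _).trans hi⟩)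
  have htend : Tendsto (fun k => (φ k : ℝ)) atTop atTop :=
    tendsto_natCast_atTop_atTop.comp hφ.tendsto_atTop
  have hPg : PP c g := by
    refine lemC h (fun k => (φ k : ℝ) • q) (fun i => ?_) γ g hg
    simpa [hqc] using htend
  obtain ⟨hs, hhs⟩ : ∃ hs : ℕ → SLd (d + 1), hs = fun k =>
    D ((φ k : ℝ) • q) * ZZ g0 v * iota (γ k) * g⁻¹ := ⟨_, rfl⟩
  have hCV : CV hs 1 := by
    have := hg.mul (CV.const g⁻¹)
    rw [mul_inv_cancel] at this
    rw [hhs]; exact this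
  have hB : ∀ᶠ k in atTop, ∀ i : Fin d, ∀ j, j ≠ i.castSucc → (hs k).1 i.castSucc j = 0 := by
    refine eventually_all.2 fun i => ?_
    have := lemB hM hc g hPg hs hCV (root i.castSucc (Fin.last d)) (by
      intro φ' hφ' τ hτ γ' y hy
      refine lemC h (fun k => τ k • root i.castSucc (Fin.last d) + (φ (φ' k) : ℝ) • q) ?_
        (fun k => γ (φ' k) * γ' k) y ?_
      · intro j
        refine tendsto_atTop_mono (fun k => ?_) (htend.comp hφ'.tendsto_atTop)
        have : 0 ≤ τ k * (root i.castSucc (Fin.last d)).1 j.castSucc := by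
          refine mul_nonneg (hτ k) ?_
          rw [root_apply, if_neg (Fin.castSucc_ne_last j)]
          split_ifs <;> norm_num
        simp only [Submodule.coe_add, Submodule.coe_smul, Pi.add_apply, Pi.smul_apply, smul_eq_mul,
          hqc, Function.comp]
        linarith
      · convert hy using 2 with k
        rw [hhs, D_add, map_mul]
        simp only []
        group)
    refine this.mono fun k hk j hj => hk _ _ ?_
    rw [root_apply, root_apply, if_neg hj, if_pos rfl, if_neg (Fin.castSucc_ne_last i)]
    split_ifs <;> norm_num
  have hpos : ∀ᶠ k in atTop, ∀ i, 0 < (hs k).1 i i := by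
    refine eventually_all.2 fun i => (hCV i i).eventually_const_lt ?_
    simp
  obtain ⟨k, hk1, hk2⟩ := (hB.and hpos).exists
  obtain ⟨A, hA⟩ : ∃ A, A = hs k := ⟨_, rfl⟩
  obtain ⟨T, hT⟩ : ∃ T, T = (φ k : ℝ) • q := ⟨_, rfl⟩
  obtain ⟨Γ, hΓ⟩ : ∃ Γ, Γ = γ k := ⟨_, rfl⟩
  have hAg : A * g = D T * ZZ g0 v * iota Γ := by
    rw [hA, hhs, hT, hΓ]; simp
  rw [← hA] at hk1 hk2
  have hrow : ∀ m (i : Fin d), lv (A * g) m i.castSucc =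
      A.1 i.castSucc i.castSucc * lv g m i.castSucc := by
    intro m i
    rw [lv_mul, mulVec, dotProduct]
    refine Finset.sum_eq_single _ (fun j _ hj => ?_) (by simp)
    rw [hk1 i j hj, zero_mul]
  have hlast : ∀ m, lv (A * g) m (Fin.last d) = ∑ j, A.1 (Fin.last d) j * lv g m j := by
    intro m
    rw [lv_mul, mulVec, dotProduct]
  have hN : ∀ m, lv (A * g) m (Fin.last d) =
      Real.exp (T.1 (Fin.last d)) * ((Γ.1 *ᵥ m) (Fin.last d) : ℤ) := by
    intro m
    rw [hAg, lv_iota, lv_D, lv_ZZ_last]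
  obtain ⟨E, hE⟩ : ∃ E, E = ∏ i : Fin d, A.1 i.castSucc i.castSucc := ⟨_, rfl⟩
  have hE0 : 0 < E := by rw [hE]; exact Finset.prod_pos fun i _ => hk2 _
  have hi0 : ∃ i0, i0 ≠ Fin.last d ∧ A.1 (Fin.last d) i0 ≠ 0 := by
    by_contra hcon
    push Not at hcon
    obtain ⟨e, he⟩ : ∃ e : Fin (d + 1) → ℤ, e = Pi.single (Fin.castSucc ⟨0, by omega⟩) 1 := ⟨_, rfl⟩
    have he0 : e ≠ 0 := by rw [he]; simp
    have hel : e (Fin.last d) = 0 := by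
      rw [he, Pi.single_eq_of_ne (Fin.castSucc_ne_last _).symm]
    obtain ⟨m, hm⟩ : ∃ m, m = (Γ⁻¹).1 *ᵥ e := ⟨_, rfl⟩
    have hm0 : m ≠ 0 := by rw [hm]; exact gamma_ne _ _ he0
    have hΓm : Γ.1 *ᵥ m = e := by
      rw [hm, mulVec_mulVec, ← Matrix.SpecialLinearGroup.coe_mul, mul_inv_cancel,
        Matrix.SpecialLinearGroup.coe_one, one_mulVec]
    have h1 := hN m
    rw [hΓm, hel, Int.cast_zero, mul_zero, hlast, Finset.sum_eq_single (Fin.last d)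
      (fun j _ hj => by rw [hcon j hj, zero_mul]) (by simp)] at h1
    rcases mul_eq_zero.1 h1 with h1 | h1
    · exact (hk2 _).ne' h1
    · exact hPg.ne hc hm0 _ h1
  obtain ⟨i0, hi0l, hi0w⟩ := hi0
  obtain ⟨j, hj⟩ : ∃ j, j ∉ ({i0, Fin.last d} : Finset (Fin (d + 1))) := by
    by_contra hcon
    push Not at hcon
    have h1 : (Finset.univ : Finset (Fin (d + 1))) ⊆ {i0, Fin.last d} := fun j _ => hcon j
    have h2 := Finset.card_le_card h1
    have h3 := Finset.card_le_two (a := i0) (b := Fin.last d)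
    rw [Finset.card_univ, Fintype.card_fin] at h2
    omega
  simp only [Finset.mem_insert, Finset.mem_singleton, not_or] at hj
  refine lemF hM hc g hPg hi0l hj.1 hj.2 (fun j => A.1 (Fin.last d) j) (hk2 _).ne' hi0w
    (c1 := c / E) (by positivity) ?_
  intro m hm
  rw [← hlast] at hm ⊢
  have hNm : (Γ.1 *ᵥ m) (Fin.last d) ≠ 0 := by
    intro h0
    rw [hN, h0] at hm
    simp at hm
  have h1 := h.prod _ hNm
  rw [← prod_D T, ← lv_iota, ← hAg, Fin.prod_univ_castSucc, abs_mul] at h1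
  simp only [hrow, Finset.prod_mul_distrib] at h1
  rw [← hE, abs_mul, abs_of_pos hE0] at h1
  have h2 : ∏ i ∈ Finset.univ.erase (Fin.last d), |lv g m i| = |∏ i : Fin d, lv g m i.castSucc| := by
    rw [Finset.abs_prod]
    have : (Finset.univ.erase (Fin.last d)) = Finset.univ.image (Fin.castSucc : Fin d → _) := by
      ext i
      simp only [Finset.mem_erase, Finset.mem_univ, and_true, Finset.mem_image, true_and]
      exact Fin.exists_castSucc_eq.symm
    rw [this, Finset.prod_image (fun _ _ _ _ h => Fin.castSucc_injective d h)]
  rw [h2, div_le_iff₀ hE0]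
  linarith

theorem HL_of_not {d : ℕ} (g : SLd d) (v : Fin d → ℝ) (h : ¬ IsL (latticeOf g) v) :
    ∃ c, 0 < c ∧ c ≤ 1 ∧ HL c g v := by
  unfold IsL at h
  obtain ⟨S, hS⟩ : ∃ S, S = {r : ℝ | ∃ n : ℤ, n ≠ 0 ∧
    r = |(n : ℝ)| * Ngrid (grid (latticeOf g) ((n : ℝ) • v))} := ⟨_, rfl⟩
  rw [← hS] at h
  have hN0 : ∀ y : Set (Fin d → ℝ), 0 ≤ Ngrid y := by
    intro y
    refine Real.sInf_nonneg ?_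
    rintro r ⟨w, -, rfl⟩
    exact abs_nonneg _
  have hS0 : ∀ r ∈ S, 0 ≤ r := by
    rw [hS]
    rintro r ⟨n, -, rfl⟩
    exact mul_nonneg (abs_nonneg _) (hN0 _)
  have hpos : 0 < sInf S := lt_of_le_of_ne (Real.sInf_nonneg hS0) (Ne.symm h)
  refine ⟨min (sInf S) 1, lt_min hpos one_pos, min_le_right _ _, fun N m hN => ?_⟩
  refine (min_le_left _ _).trans ?_
  have h1 : sInf S ≤ |(N : ℝ)| * Ngrid (grid (latticeOf g) ((N : ℝ) • v)) :=
    csInf_le ⟨0, fun r hr => hS0 r hr⟩ (by rw [hS]; exact ⟨N, hN, rfl⟩)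
  refine h1.trans (mul_le_mul_of_nonneg_left ?_ (abs_nonneg _))
  refine csInf_le ⟨0, ?_⟩ ?_
  · rintro r ⟨w, -, rfl⟩
    exact abs_nonneg _
  · refine ⟨lv g m + (N : ℝ) • v, ⟨lv g m, ⟨m, rfl⟩, rfl⟩, ?_⟩
    simp

end

/-- Margulis's conjecture in dimension `d + 1` (every bounded `A_{d+1}`-orbit in `X_{d+1}`
is compact) implies the generalized Littlewood conjecture in dimension `d`:
every grid in `ℝ^d` is L. -/
theorem stmt_5 (d : ℕ) (hd : 2 ≤ d)
    (hMargulis : ∀ z : XSp (d + 1), IsCompact (closure (Aorbit z)) → IsCompact (Aorbit z)) :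
    ∀ (g : SLd d) (v : Fin d → ℝ), IsL (latticeOf g) v := by
  intro g v
  by_contra hcon
  obtain ⟨c, hc, hc1, h⟩ := HL_of_not g v hcon
  exact main_aux hd (Mg_of (d + 1) hMargulis) hc hc1 g v h


end
end

section
/- Let y and y_0 be grids in ℝ^d and suppose that τ_{y_0} lies in the closure of the orbit A_{d+1}·τ_y in X_{d+1}. If y_0 is L, then y is L. -/
open scoped BigOperators

noncomputable section

/-- For the grid `y = x + v`, `τ_y = {(u + tv, t) : u ∈ x, t ∈ ℤ} ⊆ ℝ^{d+1}`. -/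
def tauSet {d : ℕ} (x : Set (Fin d → ℝ)) (v : Fin d → ℝ) : Set (Fin (d + 1) → ℝ) :=
  {w | ∃ u ∈ x, ∃ t : ℤ,
    (∀ i : Fin d, w i.castSucc = u i + (t : ℝ) * v i) ∧ w (Fin.last d) = (t : ℝ)}

theorem isL_iff {d : ℕ} (g : SLd d) (v : Fin d → ℝ) :
    IsL (latticeOf g) v ↔ ∀ ε : ℝ, 0 < ε → ∃ n : ℤ, n ≠ 0 ∧ ∃ u ∈ latticeOf g,
      |(n : ℝ)| * |∏ i, (u i + (n : ℝ) * v i)| < ε := by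
  have hne : (latticeOf g).Nonempty := Set.range_nonempty _
  have hbdd : ∀ n : ℤ, BddBelow {r : ℝ | ∃ w ∈ grid (latticeOf g) ((n : ℝ) • v), r = |∏ i, w i|} := by
    intro n
    refine ⟨0, ?_⟩
    rintro r ⟨w, _, rfl⟩
    exact abs_nonneg _
  have hnon : ∀ n : ℤ, 0 ≤ Ngrid (grid (latticeOf g) ((n : ℝ) • v)) := by
    intro n
    apply Real.sInf_nonneg
    rintro r ⟨w, _, rfl⟩
    exact abs_nonneg _
  have hS0 : ∀ r ∈ {r : ℝ | ∃ n : ℤ, n ≠ 0 ∧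
      r = |(n : ℝ)| * Ngrid (grid (latticeOf g) ((n : ℝ) • v))}, 0 ≤ r := by
    rintro r ⟨n, _, rfl⟩
    exact mul_nonneg (abs_nonneg _) (hnon n)
  have hSne : {r : ℝ | ∃ n : ℤ, n ≠ 0 ∧
      r = |(n : ℝ)| * Ngrid (grid (latticeOf g) ((n : ℝ) • v))}.Nonempty :=
    ⟨_, 1, one_ne_zero, rfl⟩
  constructor
  · intro h ε hε
    unfold IsL at h
    obtain ⟨r, ⟨n, hn, rfl⟩, hr⟩ := exists_lt_of_csInf_lt hSne (h.trans_lt hε)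
    have hnpos : 0 < |(n : ℝ)| := abs_pos.mpr (by exact_mod_cast hn)
    rw [mul_comm, ← lt_div_iff₀ hnpos] at hr
    obtain ⟨u0, hu0⟩ := hne
    obtain ⟨r, ⟨w, ⟨u, hu, rfl⟩, rfl⟩, hr2⟩ :=
      exists_lt_of_csInf_lt (s := {r : ℝ | ∃ w ∈ grid (latticeOf g) ((n : ℝ) • v), r = |∏ i, w i|})
        ⟨_, _, ⟨u0, hu0, rfl⟩, rfl⟩ hr
    refine ⟨n, hn, u, hu, ?_⟩
    rw [lt_div_iff₀ hnpos, mul_comm] at hr2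
    simpa using hr2
  · intro h
    apply le_antisymm _ (Real.sInf_nonneg hS0)
    apply le_of_forall_pos_lt_add
    intro ε hε
    rw [zero_add]
    obtain ⟨n, hn, u, hu, hlt⟩ := h ε hε
    refine lt_of_le_of_lt (csInf_le ⟨0, fun r hr => hS0 r hr⟩ ⟨n, hn, rfl⟩) ?_
    refine lt_of_le_of_lt (mul_le_mul_of_nonneg_left ?_ (abs_nonneg _)) hlt
    exact csInf_le (hbdd n) ⟨_, ⟨u, hu, rfl⟩, by simp⟩

theorem exists_tau {d : ℕ} (g : SLd d) (v : Fin d → ℝ) :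
    ∃ G : SLd (d + 1), latticeOf G = tauSet (latticeOf g) v := by
  obtain ⟨A, hgA, hA⟩ : ∃ A : Matrix (Fin d) (Fin d) ℝ,
    A = (g : Matrix (Fin d) (Fin d) ℝ) ∧ A.det = 1 := ⟨_, rfl, g.2⟩
  let B : Matrix (Fin d ⊕ Fin 1) (Fin d ⊕ Fin 1) ℝ :=
    Matrix.fromBlocks A (Matrix.of fun i _ => v i) 0 1
  let M : Matrix (Fin (d+1)) (Fin (d+1)) ℝ :=
    B.submatrix finSumFinEquiv.symm finSumFinEquiv.symm
  have hM : M.det = 1 := by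
    simp only [M, B, Matrix.det_submatrix_equiv_self, Matrix.det_fromBlocks_zero₂₁]
    simp [hA]
  have e1 : ∀ i : Fin d, (finSumFinEquiv (m := d) (n := 1)).symm i.castSucc = Sum.inl i :=
    fun i => finSumFinEquiv_symm_apply_castAdd i
  have e2 : (finSumFinEquiv (m := d) (n := 1)).symm (Fin.last d) = Sum.inr 0 :=
    finSumFinEquiv_symm_last
  have h1 : ∀ (x : Fin (d+1) → ℝ) (i : Fin d), M.mulVec x i.castSucc =
      A.mulVec (fun j => x j.castSucc) i + x (Fin.last d) * v i := by
    intro x i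
    simp [Matrix.mulVec, dotProduct, Fin.sum_univ_castSucc, M, B, e1, e2, mul_comm]
  have h2 : ∀ (x : Fin (d+1) → ℝ), M.mulVec x (Fin.last d) = x (Fin.last d) := by
    intro x
    simp [Matrix.mulVec, dotProduct, Fin.sum_univ_castSucc, M, B, e1, e2]
  subst hgA
  refine ⟨⟨M, hM⟩, ?_⟩
  ext w
  constructor
  · rintro ⟨m, rfl⟩
    exact ⟨_, ⟨fun j => m j.castSucc, rfl⟩, m (Fin.last d), fun i => h1 _ i, h2 _⟩
  · rintro ⟨u, ⟨m, rfl⟩, t, hw1, hw2⟩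
    refine ⟨Fin.snoc (α := fun _ => ℤ) m t, ?_⟩
    funext i
    refine Fin.lastCases ?_ (fun i => ?_) i
    · refine (h2 _).trans ?_
      simp [hw2]
    · refine (h1 _ i).trans ?_
      simp [hw1]

theorem isOpen_small (d : ℕ) (ε : ℝ) : IsOpen {q : XSp (d + 1) |
    ∃ w ∈ latticeOfX q, |∏ i, w i| < ε ∧ w (Fin.last d) ≠ 0} := by
  have hq : Topology.IsQuotientMap (Quotient.mk (latSetoid (d+1))) := isQuotientMap_quot_mk
  refine hq.isOpen_preimage.mp ?_
  have : (Quotient.mk (latSetoid (d+1))) ⁻¹' {q : XSp (d + 1) |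
      ∃ w ∈ latticeOfX q, |∏ i, w i| < ε ∧ w (Fin.last d) ≠ 0} =
      ⋃ m : Fin (d+1) → ℤ, {G : SLd (d+1) |
        |∏ i, (G : Matrix (Fin (d+1)) (Fin (d+1)) ℝ).mulVec (fun i => (m i : ℝ)) i| < ε ∧
        (G : Matrix (Fin (d+1)) (Fin (d+1)) ℝ).mulVec (fun i => (m i : ℝ)) (Fin.last d) ≠ 0} := by
    ext G
    simp only [Set.mem_iUnion]
    constructor
    · rintro ⟨w, ⟨m, rfl⟩, h⟩
      exact ⟨m, h⟩
    · rintro ⟨m, h⟩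
      exact ⟨_, ⟨m, rfl⟩, h⟩
  refine (congrArg IsOpen this).mpr ?_
  refine isOpen_iUnion fun m => ?_
  have hc : Continuous (fun G : SLd (d+1) => (G : Matrix (Fin (d+1)) (Fin (d+1)) ℝ)) :=
    continuous_induced_dom
  have hv : Continuous (fun G : SLd (d+1) =>
      (G : Matrix (Fin (d+1)) (Fin (d+1)) ℝ).mulVec (fun i => (m i : ℝ))) :=
    hc.matrix_mulVec continuous_const
  have hvi : ∀ i, Continuous (fun G : SLd (d+1) =>
      (G : Matrix (Fin (d+1)) (Fin (d+1)) ℝ).mulVec (fun i => (m i : ℝ)) i) :=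
    fun i => (continuous_apply i).comp hv
  exact (isOpen_lt (continuous_finsetProd _ fun i _ => hvi i).abs continuous_const).inter
    (isOpen_ne_fun (hvi _) continuous_const)

theorem stmt_6 (d : ℕ) (hd : 2 ≤ d) (g g0 : SLd d) (v v0 : Fin d → ℝ)
    (h : ∀ q q0 : XSp (d + 1),
        latticeOfX q = tauSet (latticeOf g) v →
        latticeOfX q0 = tauSet (latticeOf g0) v0 →
        q0 ∈ closure (Aorbit q))
    (h0 : IsL (latticeOf g0) v0) :
    IsL (latticeOf g) v := by
  rw [isL_iff] at h0 ⊢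
  intro ε hε
  obtain ⟨n, hn, u, hu, hlt⟩ := h0 ε hε
  obtain ⟨G, hG⟩ := exists_tau g v
  obtain ⟨G0, hG0⟩ := exists_tau g0 v0
  have hcl := h (Quotient.mk _ G) (Quotient.mk _ G0) hG hG0
  obtain ⟨q, hqU, a, G', ha, hz, rfl⟩ := mem_closure_iff.mp hcl _ (isOpen_small d ε) (by
    refine ⟨Fin.snoc (α := fun _ => ℝ) (fun i => u i + n * v0 i) (n : ℝ), ?_, ?_, ?_⟩
    · change _ ∈ latticeOf G0
      rw [hG0]
      exact ⟨u, hu, n, fun i => by simp, by simp⟩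
    · rw [Fin.prod_univ_castSucc]
      simp only [Fin.snoc_castSucc, Fin.snoc_last]
      rwa [abs_mul, mul_comm]
    · simpa using hn)
  obtain ⟨w, ⟨m, rfl⟩, hw1, hw2⟩ := hqU
  have hG' : latticeOf G' = tauSet (latticeOf g) v :=
    (show latticeOf G = latticeOf G' from congrArg latticeOfX hz).symm.trans hG
  let w' := (G' : Matrix (Fin (d+1)) (Fin (d+1)) ℝ).mulVec (fun i => (m i : ℝ))
  have hw' : w' ∈ tauSet (latticeOf g) v := hG' ▸ ⟨m, rfl⟩
  have hdiag : (a : Matrix (Fin (d+1)) (Fin (d+1)) ℝ) =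
      Matrix.diagonal (fun i => (a : Matrix (Fin (d+1)) (Fin (d+1)) ℝ) i i) := by
    ext i j
    by_cases hij : i = j
    · subst hij; simp
    · rw [Matrix.diagonal_apply_ne _ hij, ha.2 i j hij]
  have hdet : ∏ i, (a : Matrix (Fin (d+1)) (Fin (d+1)) ℝ) i i = 1 := by
    rw [← Matrix.det_diagonal, ← hdiag]
    exact a.2
  have hmul : ∀ i, ((a * G' : SLd (d+1)) : Matrix (Fin (d+1)) (Fin (d+1)) ℝ).mulVec
      (fun i => (m i : ℝ)) i = (a : Matrix (Fin (d+1)) (Fin (d+1)) ℝ) i i * w' i := by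
    intro i
    rw [Matrix.SpecialLinearGroup.coe_mul, ← Matrix.mulVec_mulVec]
    conv_lhs => rw [hdiag]
    rw [Matrix.mulVec_diagonal]
  simp only [hmul, Finset.prod_mul_distrib, hdet, one_mul] at hw1 hw2
  obtain ⟨u', hu', t, ht1, ht2⟩ := hw'
  refine ⟨t, ?_, u', hu', ?_⟩
  · rintro rfl
    apply hw2
    rw [ht2]; simp
  · rw [Fin.prod_univ_castSucc, ht2, abs_mul, mul_comm] at hw1
    simpa only [ht1] using hw1

end
end
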